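/- Let R = ∏_{i=1}^m R_i and R' = ∏_{j=1}^{m'} R'_j with R_i = End_{K_i}(U_i), R'_j = End_{K'_j}(U'_j), where all U_i, U'_j are left vector spaces over fields with 1 ≤ dim U_i, dim U'_j < ∞. For a mapping φ: ℙ(R) → ℙ(R'), the following are equivalent: (1) φ is a △-isomorphism; (2) m = m' and there is a permutation σ of {1,…,m} such that for each p ∈ ℙ(R) and each k ∈ {1,…,m} one has (φ(p))_{σ(k)} = φ_k(p_k) for △-isomorphisms φ_k: ℙ(R_k) → ℙ(R'_{σ(k)}). Moreover, in this case, if dim U_i > 1 for all i ∈ {1,…,m}, then φ = α̃ ∘ γ̃, where γ ∈ GL₂(R') and α: R → R' is a Jordan isomorphism such that for each x ∈ R and each k ∈ {1,…,m}, (x^α)_{σ(k)} = (x_k)^{α_k} with α_k: R_k → R'_{σ(k)} an isomorphism or an anti-isomorphism of rings. -/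

import Mathlib

/-- `p` is a point of the projective line over `R`. -/
def IsPoint (R : Type*) [Ring R] (p : Submodule R (R × R)) : Prop :=
  ∃ g : (Matrix (Fin 2) (Fin 2) R)ˣ,
    p = Submodule.span R {(g.val 0 0, g.val 0 1)}

/-- distant relation -/
def Distant {R : Type*} [Ring R] (p q : Submodule R (R × R)) : Prop :=
  ∃ g : (Matrix (Fin 2) (Fin 2) R)ˣ,
    p = Submodule.span R {(g.val 0 0, g.val 0 1)} ∧
    q = Submodule.span R {(g.val 1 0, g.val 1 1)}

/-- `△(p)`: the set of points distant to `p`. -/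
def DistantSet {R : Type*} [Ring R] (p : Submodule R (R × R)) :
    Set (Submodule R (R × R)) := {x | Distant x p}

/-- `p ∥ q` iff `△(p) ⊆ △(q)`. -/
def Parallel {R : Type*} [Ring R] (p q : Submodule R (R × R)) : Prop :=
  DistantSet p ⊆ DistantSet q

/-- `p ∼ q` via `r`: `r ∦ p`, `r ∦ q` and `△(r) ⊆ △(p) ∪ △(q)`. -/
def AdjacentVia {R : Type*} [Ring R] (p q r : Submodule R (R × R)) : Prop :=
  ¬ Parallel r p ∧ ¬ Parallel r q ∧ DistantSet r ⊆ DistantSet p ∪ DistantSet q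

/-- `p ∼ q`: there is a point `r` with `p ∼ q` via `r`. -/
def Adjacent {R : Type*} [Ring R] (p q : Submodule R (R × R)) : Prop :=
  ∃ r, IsPoint R r ∧ AdjacentVia p q r

/-- The `j`-th component projection `(Π R_i)² → (R j)²`, semilinear over evaluation. -/
def compMap {I : Type*} (R : I → Type*) [∀ i, Ring (R i)] (j : I) :
    ((Π i, R i) × (Π i, R i)) →ₛₗ[Pi.evalRingHom R j] (R j × R j) where
  toFun x := (x.1 j, x.2 j)
  map_add' _ _ := rfl
  map_smul' _ _ := rfl

instance {I : Type*} (R : I → Type*) [∀ i, Ring (R i)] (j : I) :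
    RingHomSurjective (Pi.evalRingHom R j) :=
  ⟨fun x => by classical exact ⟨Pi.single j x, Pi.single_eq_same j x⟩⟩

/-- The `j`-th component of a point of `ℙ(Π R_i)` under the canonical identification of
`ℙ(Π R_i)` with `Π ℙ(R_i)`: the image of `R(a,b)` is `R_j(a_j, b_j)`. -/
def component {I : Type*} {R : I → Type*} [∀ i, Ring (R i)]
    (p : Submodule (Π i, R i) ((Π i, R i) × (Π i, R i))) (j : I) :
    Submodule (R j) (R j × R j) :=
  Submodule.map (compMap R j) p

open MulOpposite

/-- `End_K(U)` with endomorphisms written on the right, as in the paper. -/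
abbrev EndOp (K U : Type*) [DivisionRing K] [AddCommGroup U] [Module K U] :=
  (Module.End K U)ᵐᵒᵖ

/-- The projective line over `R` (as a type). -/
abbrev PL (R : Type*) [Ring R] := {p : Submodule R (R × R) // IsPoint R p}

/-- The row vector `(x, y)` multiplied by the `2×2` matrix `γ`. -/
def rowMul {S : Type*} [Ring S] (x y : S) (γ : Matrix (Fin 2) (Fin 2) S) : S × S :=
  (x * γ 0 0 + y * γ 1 0, x * γ 0 1 + y * γ 1 1)

/-- `f` is a `△`-isomorphism `ℙ(A) → ℙ(B)` (for a map defined on all submodules: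
it is a bijection between the point sets preserving `△` in both directions). -/
def IsDisIso {A B : Type*} [Ring A] [Ring B]
    (f : Submodule A (A × A) → Submodule B (B × B)) : Prop :=
  Set.BijOn f {p | IsPoint A p} {q | IsPoint B q} ∧
    ∀ p q, IsPoint A p → IsPoint A q → (Distant p q ↔ Distant (f p) (f q))

namespace DistantGeometry

open Module

/-- `r` lies on the pencil spanned by `p` and `q`: every point distant to `r` is distant
to `p` or to `q`. -/
def Near {P : Type*} (D : P → P → Prop) (p q r : P) : Prop :=
  ∀ z, D z r → D z p ∨ D z q

/-- Adjacency, defined through the distant relation. -/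
def Adj {P : Type*} (D : P → P → Prop) (p q : P) : Prop :=
  ∃ r, r ≠ p ∧ r ≠ q ∧ Near D p q r

/-- The properties of a distant relation on which the decomposition of products rests. -/
structure IsGeometry {P : Type*} (D : P → P → Prop) : Prop where
  eq_of_forall : ∀ p r, (∀ z, D z r → D z p) → r = p
  exists_distant : ∀ p, ∃ z, D z p
  exists_adj : ∀ p, ∃ q, Adj D p q
  local_connected : ∀ p q q', Adj D p q → Adj D p q' →
    ∃ s, Adj D p s ∧ (s = q ∨ Adj D s q) ∧ (s = q' ∨ Adj D s q')
  connected : ∀ p q, Relation.ReflTransGen (Adj D) p q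

section Basic

variable {P Q : Type*} {D : P → P → Prop} {E : Q → Q → Prop}

theorem Adj.symm {p q : P} (h : Adj D p q) : Adj D q p := by
  obtain ⟨r, h1, h2, h3⟩ := h
  exact ⟨r, h2, h1, fun z hz => (h3 z hz).symm⟩

theorem IsGeometry.adj_ne (hD : IsGeometry D) {p q : P} (h : Adj D p q) : p ≠ q := by
  rintro rfl
  obtain ⟨r, h1, h2, h3⟩ := h
  exact h1 (hD.eq_of_forall _ _ fun z hz => (h3 z hz).elim id id)

theorem near_equiv (e : P ≃ Q) (he : ∀ p q, D p q ↔ E (e p) (e q)) (p q r : P) :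
    Near D p q r ↔ Near E (e p) (e q) (e r) := by
  constructor
  · intro h z hz
    obtain ⟨z, rfl⟩ := e.surjective z
    rw [← he, ← he]
    exact h z ((he _ _).2 hz)
  · intro h z hz
    rw [he, he z]
    exact h _ ((he _ _).1 hz)

theorem adj_equiv (e : P ≃ Q) (he : ∀ p q, D p q ↔ E (e p) (e q)) (p q : P) :
    Adj D p q ↔ Adj E (e p) (e q) := by
  constructor
  · rintro ⟨r, h1, h2, h3⟩
    exact ⟨e r, e.injective.ne h1, e.injective.ne h2, (near_equiv e he _ _ _).1 h3⟩
  · rintro ⟨r, h1, h2, h3⟩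
    obtain ⟨r, rfl⟩ := e.surjective r
    exact ⟨r, fun h => h1 (h ▸ rfl), fun h => h2 (h ▸ rfl), (near_equiv e he _ _ _).2 h3⟩

theorem IsGeometry.of_equiv (e : P ≃ Q) (he : ∀ p q, D p q ↔ E (e p) (e q))
    (hE : IsGeometry E) : IsGeometry D where
  eq_of_forall p r h := e.injective <| hE.eq_of_forall _ _ fun z hz => by
    obtain ⟨z, rfl⟩ := e.surjective z
    exact (he _ _).1 (h z ((he _ _).2 hz))
  exists_distant p := by
    obtain ⟨z, hz⟩ := hE.exists_distant (e p)
    obtain ⟨z, rfl⟩ := e.surjective z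
    exact ⟨z, (he _ _).2 hz⟩
  exists_adj p := by
    obtain ⟨z, hz⟩ := hE.exists_adj (e p)
    obtain ⟨z, rfl⟩ := e.surjective z
    exact ⟨z, (adj_equiv e he _ _).2 hz⟩
  local_connected p q q' h h' := by
    obtain ⟨s, h1, h2, h3⟩ := hE.local_connected _ _ _ ((adj_equiv e he _ _).1 h)
      ((adj_equiv e he _ _).1 h')
    obtain ⟨s, rfl⟩ := e.surjective s
    refine ⟨s, (adj_equiv e he _ _).2 h1, ?_, ?_⟩
    · rw [adj_equiv e he]
      exact h2.imp_left fun h => e.injective h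
    · rw [adj_equiv e he]
      exact h3.imp_left fun h => e.injective h
  connected p q := by
    have key : ∀ x y, Relation.ReflTransGen (Adj E) x y →
        Relation.ReflTransGen (Adj D) (e.symm x) (e.symm y) := by
      intro x y h
      refine Relation.ReflTransGen.lift _ (fun a b hab => ?_) _ _ h
      rw [Function.onFun, adj_equiv e he]
      simpa using hab
    simpa using key _ _ (hE.connected (e p) (e q))

end Basic

section Product

variable {I : Type*} {P : I → Type*}

/-- The componentwise distant relation on a product. -/
def PiRel (D : ∀ i, P i → P i → Prop) (x y : ∀ i, P i) : Prop := ∀ i, D i (x i) (y i)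

/-- Adjacency in the direction of the component `i`. -/
def AdjAt (D : ∀ i, P i → P i → Prop) (i : I) (x y : ∀ i, P i) : Prop :=
  Adj (D i) (x i) (y i) ∧ ∀ j, j ≠ i → x j = y j

variable {D : ∀ i, P i → P i → Prop}

theorem AdjAt.symm {i : I} {x y : ∀ i, P i} (h : AdjAt D i x y) : AdjAt D i y x :=
  ⟨h.1.symm, fun j hj => (h.2 j hj).symm⟩

theorem AdjAt.apply_ne (hD : ∀ i, IsGeometry (D i)) {i : I} {x y : ∀ i, P i}
    (h : AdjAt D i x y) : x i ≠ y i := (hD i).adj_ne h.1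

theorem AdjAt.eq_of_ne {i j : I} {x y : ∀ i, P i} (h : AdjAt D i x y) (hj : x j ≠ y j) :
    j = i := by
  by_contra hne
  exact hj (h.2 j hne)

theorem AdjAt.unique (hD : ∀ i, IsGeometry (D i)) {i j : I} {x y : ∀ i, P i}
    (h : AdjAt D i x y) (h' : AdjAt D j x y) : i = j :=
  h'.eq_of_ne (h.apply_ne hD)

open Classical in
theorem adj_piRel_iff (hD : ∀ i, IsGeometry (D i)) (x y : ∀ i, P i) :
    Adj (PiRel D) x y ↔ ∃ i, AdjAt D i x y := by
  constructor
  · rintro ⟨r, hrx, hry, hr⟩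
    choose z hz using fun i => (hD i).exists_distant (r i)
    have key : ∀ i j, r i ≠ x i → r j ≠ y j → i = j := by
      intro i j hi hj
      by_contra hij
      have hi' : ∃ w, D i w (r i) ∧ ¬ D i w (x i) := by
        by_contra hcon
        push Not at hcon
        exact hi ((hD i).eq_of_forall _ _ hcon)
      have hj' : ∃ w, D j w (r j) ∧ ¬ D j w (y j) := by
        by_contra hcon
        push Not at hcon
        exact hj ((hD j).eq_of_forall _ _ hcon)
      obtain ⟨w, hw1, hw2⟩ := hi'
      obtain ⟨v, hv1, hv2⟩ := hj'
      have hd : PiRel D (Function.update (Function.update z i w) j v) r := by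
        intro k
        by_cases hk : k = j
        · subst hk; simpa using hv1
        · rw [Function.update_of_ne hk]
          by_cases hk' : k = i
          · subst hk'; simpa using hw1
          · rw [Function.update_of_ne hk']; exact hz k
      rcases hr _ hd with h | h
      · have := h i
        rw [Function.update_of_ne hij, Function.update_self] at this
        exact hw2 this
      · have := h j
        rw [Function.update_self] at this
        exact hv2 this
    obtain ⟨i, hi⟩ := Function.ne_iff.1 hrx
    obtain ⟨j, hj⟩ := Function.ne_iff.1 hry
    obtain rfl := key i j hi hj
    have hx : ∀ k, k ≠ i → r k = x k := fun k hk => by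
      by_contra h
      exact hk (key k i h hj)
    have hy : ∀ k, k ≠ i → r k = y k := fun k hk => by
      by_contra h
      exact hk (key i k hi h).symm
    refine ⟨i, ⟨r i, hi, hj, fun w hw => ?_⟩, fun k hk => (hx k hk).symm.trans (hy k hk)⟩
    have hd : PiRel D (Function.update z i w) r := by
      intro k
      by_cases hk : k = i
      · subst hk; simpa using hw
      · rw [Function.update_of_ne hk]; exact hz k
    exact (hr _ hd).imp (fun h => by simpa using h i) (fun h => by simpa using h i)
  · rintro ⟨i, ⟨r, h1, h2, h3⟩, h4⟩
    refine ⟨Function.update x i r, fun h => h1 ?_, fun h => h2 ?_, fun z hz => ?_⟩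
    · simpa using congrFun h i
    · simpa using congrFun h i
    · have hzi : D i (z i) r := by simpa using hz i
      have hzk : ∀ k, k ≠ i → D k (z k) (x k) := fun k hk => by
        simpa [Function.update_of_ne hk] using hz k
      refine (h3 _ hzi).imp (fun h k => ?_) (fun h k => ?_)
      · by_cases hk : k = i
        · subst hk; exact h
        · exact hzk k hk
      · by_cases hk : k = i
        · subst hk; exact h
        · rw [← h4 k hk]; exact hzk k hk

/-- In a triangle all edges have the same direction. -/
theorem AdjAt.of_triangle (hD : ∀ i, IsGeometry (D i)) {i j : I} {a b c : ∀ i, P i}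
    (hab : AdjAt D i a b) (hac : AdjAt D j a c) (hbc : b = c ∨ ∃ k, AdjAt D k b c) :
    i = j := by
  rcases hbc with rfl | ⟨k, hbc⟩
  · exact hab.unique hD hac
  · by_contra hij
    have h1 : i = k := hbc.eq_of_ne fun h =>
      hab.apply_ne hD ((hac.2 i hij).trans h.symm)
    have h2 : j = k := hbc.eq_of_ne fun h =>
      hac.apply_ne hD ((hab.2 j (Ne.symm hij)).trans h)
    exact hij (h1.trans h2.symm)

/-- Opposite edges of a proper square have the same direction. -/
theorem AdjAt.of_square (hD : ∀ i, IsGeometry (D i)) {i j k l : I} {a b c d : ∀ i, P i}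
    (hij : i ≠ j) (hab : AdjAt D i a b) (hac : AdjAt D j a c) (hbd : AdjAt D k b d)
    (hcd : AdjAt D l c d) (hda : d ≠ a) : l = i := by
  by_contra hli
  have hbc : b i ≠ c i := fun h => hab.apply_ne hD ((hac.2 i hij).trans h.symm)
  have hcdi : c i = d i := hcd.2 i (Ne.symm hli)
  have hki : i = k := hbd.eq_of_ne (by rw [← hcdi]; exact hbc)
  have hbj : b j = a j := (hab.2 j (Ne.symm hij)).symm
  have hdj : d j = b j := (hbd.2 j (by rw [← hki]; exact Ne.symm hij)).symm
  have hjl : j = l := hcd.eq_of_ne (by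
    rw [hdj, hbj]
    exact (hac.apply_ne hD).symm)
  refine hda (funext fun m => ?_)
  by_cases hm : m = j
  · subst hm; exact hdj.trans hbj
  · rw [← hcd.2 m (by rw [← hjl]; exact hm), ← hac.2 m hm]

open Classical in
theorem AdjAt.update (x : ∀ i, P i) {i : I} {p q : P i} (h : Adj (D i) p q) :
    AdjAt D i (Function.update x i p) (Function.update x i q) :=
  ⟨by simpa using h, fun j hj => by simp [Function.update_of_ne hj]⟩

open Classical in
/-- Any two points are joined by a path which uses only directions in which they differ. -/
theorem reflTransGen_adjAt [Finite I] (hD : ∀ i, IsGeometry (D i)) (x y : ∀ i, P i) :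
    Relation.ReflTransGen (fun a b => ∃ i, x i ≠ y i ∧ AdjAt D i a b) x y := by
  have := Fintype.ofFinite I
  have key : ∀ s : Finset I, Relation.ReflTransGen
      (fun a b => ∃ i, x i ≠ y i ∧ AdjAt D i a b) x (s.piecewise y x) := by
    intro s
    induction s using Finset.induction_on with
    | empty => simpa using Relation.ReflTransGen.refl
    | insert i s _ ih =>
      rw [Finset.piecewise_insert]
      refine ih.trans ?_
      by_cases hi : x i = y i
      · have : Function.update (s.piecewise y x) i (y i) = s.piecewise y x := by
          rw [Function.update_eq_self_iff]
          by_cases his : i ∈ s <;> simp [his, hi]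
        rw [this]
      · have h1 := (hD i).connected (s.piecewise y x i) (y i)
        have h2 := Relation.ReflTransGen.lift
          (p := fun a b => ∃ i, x i ≠ y i ∧ AdjAt D i a b)
          (fun p => Function.update (s.piecewise y x) i p)
          (fun p q hpq => ⟨i, hi, AdjAt.update _ hpq⟩) _ _ h1
        simpa [Function.onFun] using h2
  simpa using key Finset.univ

end Product

section Decomposition

variable {I J : Type*} {P : I → Type*} {Q : J → Type*}
  {D : ∀ i, P i → P i → Prop} {E : ∀ j, Q j → Q j → Prop}

/-- The direction `i` at `x` is mapped to the direction `j` by `F`. -/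
def DirMap (D : ∀ i, P i → P i → Prop) (E : ∀ j, Q j → Q j → Prop)
    (F : (∀ i, P i) ≃ (∀ j, Q j)) (x : ∀ i, P i) (i : I) (j : J) : Prop :=
  ∃ y, AdjAt D i x y ∧ AdjAt E j (F x) (F y)

theorem exists_adjAt_iff (hD : ∀ i, IsGeometry (D i)) (hE : ∀ j, IsGeometry (E j))
    (F : (∀ i, P i) ≃ (∀ j, Q j)) (hF : ∀ x y, PiRel D x y ↔ PiRel E (F x) (F y))
    (x y : ∀ i, P i) : (∃ i, AdjAt D i x y) ↔ ∃ j, AdjAt E j (F x) (F y) := by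
  rw [← adj_piRel_iff hD, ← adj_piRel_iff hE, adj_equiv F hF]

open Classical in
theorem DirMap.adjAt (hD : ∀ i, IsGeometry (D i)) (hE : ∀ j, IsGeometry (E j))
    {F : (∀ i, P i) ≃ (∀ j, Q j)} (hF : ∀ x y, PiRel D x y ↔ PiRel E (F x) (F y))
    {x y : ∀ i, P i} {i : I} {j : J} (h : DirMap D E F x i j) (hxy : AdjAt D i x y) :
    AdjAt E j (F x) (F y) := by
  obtain ⟨w, hw, hw'⟩ := h
  obtain ⟨s, hs1, hs2, hs3⟩ := (hD i).local_connected _ _ _ hw.1 hxy.1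
  have hs : AdjAt D i x (Function.update x i s) :=
    ⟨by simpa using hs1, fun k hk => by simp [Function.update_of_ne hk]⟩
  have hsu : ∀ u, AdjAt D i x u → (s = u i ∨ Adj (D i) s (u i)) →
      F (Function.update x i s) = F u ∨
        ∃ k, AdjAt E k (F (Function.update x i s)) (F u) := by
    rintro u hu (h | h)
    · left
      congr 1
      funext k
      by_cases hk : k = i
      · subst hk; simpa using h
      · rw [Function.update_of_ne hk]; exact hu.2 k hk
    · right
      rw [← exists_adjAt_iff hD hE F hF]
      refine ⟨i, by simpa using h, fun k hk => ?_⟩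
      rw [Function.update_of_ne hk]; exact hu.2 k hk
  obtain ⟨k, hk⟩ := (exists_adjAt_iff hD hE F hF _ _).1 ⟨i, hs⟩
  obtain ⟨l, hl⟩ := (exists_adjAt_iff hD hE F hF _ _).1 ⟨i, hxy⟩
  have h1 : k = j := hk.of_triangle hE hw' (hsu w hw hs2)
  have h2 : k = l := hk.of_triangle hE hl (hsu y hxy hs3)
  rw [← h1, h2]
  exact hl

theorem DirMap.unique (hD : ∀ i, IsGeometry (D i)) (hE : ∀ j, IsGeometry (E j))
    {F : (∀ i, P i) ≃ (∀ j, Q j)} (hF : ∀ x y, PiRel D x y ↔ PiRel E (F x) (F y))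
    {x : ∀ i, P i} {i : I} {j j' : J} (h : DirMap D E F x i j)
    (h' : DirMap D E F x i j') : j = j' := by
  obtain ⟨y, hy, hy'⟩ := h'
  exact (h.adjAt hD hE hF hy).unique hE hy'

theorem DirMap.symm {F : (∀ i, P i) ≃ (∀ j, Q j)} {x : ∀ i, P i} {i : I} {j : J}
    (h : DirMap D E F x i j) : DirMap E D F.symm (F x) j i := by
  obtain ⟨y, h1, h2⟩ := h
  exact ⟨F y, h2, by simpa using h1⟩

theorem piRel_symm_iff {F : (∀ i, P i) ≃ (∀ j, Q j)}
    (hF : ∀ x y, PiRel D x y ↔ PiRel E (F x) (F y)) (x y : ∀ j, Q j) :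
    PiRel E x y ↔ PiRel D (F.symm x) (F.symm y) := by
  rw [hF]; simp

theorem DirMap.injective (hD : ∀ i, IsGeometry (D i)) (hE : ∀ j, IsGeometry (E j))
    {F : (∀ i, P i) ≃ (∀ j, Q j)} (hF : ∀ x y, PiRel D x y ↔ PiRel E (F x) (F y))
    {x : ∀ i, P i} {i i' : I} {j : J} (h : DirMap D E F x i j)
    (h' : DirMap D E F x i' j) : i = i' :=
  h.symm.unique hE hD (piRel_symm_iff hF) h'.symm

open Classical in
theorem exists_dirMap (hD : ∀ i, IsGeometry (D i)) (hE : ∀ j, IsGeometry (E j))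
    {F : (∀ i, P i) ≃ (∀ j, Q j)} (hF : ∀ x y, PiRel D x y ↔ PiRel E (F x) (F y))
    (x : ∀ i, P i) (i : I) : ∃ j, DirMap D E F x i j := by
  obtain ⟨q, hq⟩ := (hD i).exists_adj (x i)
  have h : AdjAt D i x (Function.update x i q) := by
    simpa using AdjAt.update x hq
  obtain ⟨j, hj⟩ := (exists_adjAt_iff hD hE F hF _ _).1 ⟨i, h⟩
  exact ⟨j, _, h, hj⟩

open Classical in
theorem DirMap.of_adjAt (hD : ∀ i, IsGeometry (D i)) (hE : ∀ j, IsGeometry (E j))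
    {F : (∀ i, P i) ≃ (∀ j, Q j)} (hF : ∀ x y, PiRel D x y ↔ PiRel E (F x) (F y))
    {x x' : ∀ i, P i} {i k : I} {j : J} (h : DirMap D E F x i j) (hx : AdjAt D k x x') :
    DirMap D E F x' i j := by
  by_cases hik : i = k
  · subst hik
    exact ⟨x, hx.symm, (h.adjAt hD hE hF hx).symm⟩
  · obtain ⟨l, hl⟩ := exists_dirMap hD hE hF x k
    have hjl : j ≠ l := by
      rintro rfl
      exact hik (h.injective hD hE hF hl)
    have hl' := hl.adjAt hD hE hF hx
    obtain ⟨y, hy, hy'⟩ := h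
    have h1 : AdjAt D i x' (Function.update x' i (y i)) := by
      refine ⟨?_, fun m hm => by rw [Function.update_of_ne hm]⟩
      rw [Function.update_self, ← hx.2 i hik]
      exact hy.1
    have h2 : AdjAt D k y (Function.update x' i (y i)) := by
      refine ⟨?_, fun m hm => ?_⟩
      · rw [Function.update_of_ne (Ne.symm hik), ← hy.2 k (Ne.symm hik)]
        exact hx.1
      · by_cases hmi : m = i
        · subst hmi; simp
        · rw [Function.update_of_ne hmi, ← hy.2 m hmi, hx.2 m hm]
    obtain ⟨m, hm⟩ := (exists_adjAt_iff hD hE F hF _ _).1 ⟨_, h1⟩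
    obtain ⟨m', hm'⟩ := (exists_adjAt_iff hD hE F hF _ _).1 ⟨_, h2⟩
    refine ⟨_, h1, ?_⟩
    have hne : F (Function.update x' i (y i)) ≠ F x := fun h => by
      have := congrFun (F.injective h) i
      rw [Function.update_self] at this
      exact hy.apply_ne hD this.symm
    rwa [AdjAt.of_square hE hjl hy' hl' hm' hm hne] at hm

open Classical in
/-- A bijection between finite products of geometries which preserves the componentwise
distant relation permutes the components. -/
theorem exists_decomposition [Finite I] (hD : ∀ i, IsGeometry (D i))
    (hE : ∀ j, IsGeometry (E j)) (F : (∀ i, P i) ≃ (∀ j, Q j))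
    (hF : ∀ x y, PiRel D x y ↔ PiRel E (F x) (F y)) (x₀ : ∀ i, P i) :
    ∃ (σ : I ≃ J) (f : ∀ i, P i ≃ Q (σ i)),
      (∀ i p q, D i p q ↔ E (σ i) (f i p) (f i q)) ∧ ∀ x i, F x (σ i) = f i (x i) := by
  choose σ hσ using exists_dirMap hD hE hF x₀
  have hσ' : ∀ i x, DirMap D E F x i (σ i) := by
    intro i x
    have := reflTransGen_adjAt hD x₀ x
    generalize hR : (fun a b => ∃ i, x₀ i ≠ x i ∧ AdjAt D i a b) = R at this
    have hR' : ∀ a b, R a b → ∃ k, AdjAt D k a b := by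
      rintro a b h
      rw [← hR] at h
      exact h.imp fun _ h => h.2
    clear hR
    induction this with
    | refl => exact hσ i
    | tail _ h ih =>
      obtain ⟨k, hk⟩ := hR' _ _ h
      exact ih.of_adjAt hD hE hF hk
  have hbij : Function.Bijective σ := by
    refine ⟨fun i i' h => ?_, fun j => ?_⟩
    · exact (hσ i).injective hD hE hF (h ▸ hσ i')
    · obtain ⟨i, hi⟩ := exists_dirMap hE hD (piRel_symm_iff hF) (F x₀) j
      have := hi.symm
      simp only [Equiv.symm_symm, Equiv.symm_apply_apply] at this
      exact ⟨i, (hσ i).unique hD hE hF this⟩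
  have hcomp : ∀ i x y, x i = y i → F x (σ i) = F y (σ i) := by
    intro i x y hxy
    have := reflTransGen_adjAt hD x y
    generalize hR : (fun a b => ∃ i, x i ≠ y i ∧ AdjAt D i a b) = R at this
    have hR' : ∀ a b, R a b → ∃ k, k ≠ i ∧ AdjAt D k a b := by
      rintro a b h
      rw [← hR] at h
      obtain ⟨k, hk, hk'⟩ := h
      exact ⟨k, fun h => hk (h ▸ hxy), hk'⟩
    clear hR hxy
    induction this with
    | refl => rfl
    | tail _ h ih =>
      obtain ⟨k, hk, hk'⟩ := hR' _ _ h
      rw [ih]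
      exact ((hσ' k _).adjAt hD hE hF hk').2 _ fun h => hk (hbij.1 h).symm
  have hf : ∀ x i, F x (σ i) = F (Function.update x₀ i (x i)) (σ i) :=
    fun x i => hcomp i _ _ (by simp)
  have hfb : ∀ i, Function.Bijective fun p : P i => F (Function.update x₀ i p) (σ i) := by
    intro i
    refine ⟨fun p q h => ?_, fun q => ?_⟩
    · have : F (Function.update x₀ i p) = F (Function.update x₀ i q) := by
        funext j
        obtain ⟨k, rfl⟩ := hbij.2 j
        by_cases hk : k = i
        · subst hk; exact h
        · exact hcomp k _ _ (by simp [Function.update_of_ne hk])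
      simpa using congrFun (F.injective this) i
    · refine ⟨F.symm (Function.update (F x₀) (σ i) q) i, ?_⟩
      simp only
      rw [← hf]
      simp
  choose z hz using fun i => (hD i).exists_distant (x₀ i)
  have hD1 : ∀ i (p q : P i), D i p q →
      E (σ i) (F (Function.update x₀ i p) (σ i)) (F (Function.update x₀ i q) (σ i)) := by
    intro i p q h
    have h1 : PiRel D (Function.update z i p) (Function.update x₀ i q) := by
      intro k
      by_cases hk : k = i
      · subst hk; simpa using h
      · rw [Function.update_of_ne hk, Function.update_of_ne hk]; exact hz k
    have h2 := (hF _ _).1 h1 (σ i)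
    rwa [hf (Function.update z i p), Function.update_self] at h2
  refine ⟨Equiv.ofBijective σ hbij, fun i => Equiv.ofBijective _ (hfb i), fun i p q => ?_, hf⟩
  refine ⟨hD1 i p q, fun h => ?_⟩
  have h1 : PiRel E (F (Function.update z i p)) (F (Function.update x₀ i q)) := by
    intro j
    obtain ⟨k, rfl⟩ := hbij.2 j
    rw [hf, hf (Function.update x₀ i q)]
    by_cases hk : k = i
    · subst hk; simp only [Function.update_self]; exact h
    · rw [Function.update_of_ne hk, Function.update_of_ne hk]; exact hD1 _ _ _ (hz k)
  simpa using (hF _ _).2 h1 i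

end Decomposition

section Subspaces

variable {K V : Type*} [DivisionRing K] [AddCommGroup V] [Module K V]

theorem exists_mem_notMem_notMem {P A B : Submodule K V} (hA : ¬ P ≤ A) (hB : ¬ P ≤ B) :
    ∃ z ∈ P, z ∉ A ∧ z ∉ B := by
  obtain ⟨a, haP, ha⟩ := SetLike.not_le_iff_exists.1 hA
  obtain ⟨b, hbP, hb⟩ := SetLike.not_le_iff_exists.1 hB
  by_cases haB : a ∈ B
  · by_cases hbA : b ∈ A
    · exact ⟨a + b, add_mem haP hbP, fun h => ha ((A.add_mem_iff_left hbA).1 h),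
        fun h => hb ((B.add_mem_iff_right haB).1 h)⟩
    · exact ⟨b, hbP, hbA, hb⟩
  · exact ⟨a, haP, ha, haB⟩

theorem disjoint_span_of_notMem {X : Submodule K V} {v : V} (hv : v ∉ X) :
    Disjoint X (K ∙ v) := by
  rw [Submodule.disjoint_def]
  intro x hx hx'
  obtain ⟨c, rfl⟩ := Submodule.mem_span_singleton.1 hx'
  by_cases hc : c = 0
  · simp [hc]
  · exact absurd ((X.smul_mem_iff hc).1 hx) hv

theorem not_disjoint_of_mem {X Y : Submodule K V} {v : V} (hv : v ≠ 0) (hX : v ∈ X)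
    (hY : v ∈ Y) : ¬ Disjoint X Y := fun h => hv (Submodule.disjoint_def.1 h v hX hY)

theorem not_isCompl_of_mem {X Y : Submodule K V} {v : V} (hv : v ≠ 0) (hX : v ∈ X)
    (hY : v ∈ Y) : ¬ IsCompl X Y := fun h => not_disjoint_of_mem hv hX hY h.disjoint

variable [FiniteDimensional K V]

theorem eq_of_le_of_finrank_eq {X Y : Submodule K V} (h : X ≤ Y)
    (hXY : finrank K X = finrank K Y) : X = Y :=
  Submodule.eq_of_le_of_finrank_eq h hXY

theorem isCompl_of_disjoint {X Y : Submodule K V} (h : Disjoint X Y)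
    (hXY : finrank K X + finrank K Y = finrank K V) : IsCompl X Y := by
  refine ⟨h, codisjoint_iff.2 (Submodule.eq_top_of_finrank_eq ?_)⟩
  have := Submodule.finrank_sup_add_finrank_inf_eq X Y
  rw [h.eq_bot, finrank_bot] at this
  omega

theorem finrank_add_one_eq {H X : Submodule K V} (hH : H ≤ X) {x : V} (hx : x ∈ X)
    (hxH : x ∉ H) (h : ∀ y ∈ X, ∃ c : K, y - c • x ∈ H) :
    finrank K H + 1 = finrank K X := by
  rw [← Submodule.finrank_sup_span_singleton hxH]
  have : H ⊔ (K ∙ x) = X := by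
    refine le_antisymm (sup_le hH ((Submodule.span_singleton_le_iff_mem _ _).2 hx))
      fun y hy => ?_
    obtain ⟨c, hc⟩ := h y hy
    rw [Submodule.mem_sup]
    exact ⟨y - c • x, hc, c • x,
      Submodule.smul_mem _ _ (Submodule.mem_span_singleton_self _), by simp⟩
  rw [this]

/-- Between a proper subspace and a space there is a hyperplane of the latter. -/
theorem exists_hyperplane {P X : Submodule K V} (hPX : P ≤ X) (hX : ¬ X ≤ P) :
    ∃ H, P ≤ H ∧ H ≤ X ∧ finrank K H + 1 = finrank K X := by
  obtain ⟨x, hx, hxP⟩ := SetLike.not_le_iff_exists.1 hX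
  obtain ⟨f, hf, hPf⟩ := Submodule.exists_le_ker_of_notMem hxP
  refine ⟨X ⊓ LinearMap.ker f, le_inf hPX hPf, inf_le_left, ?_⟩
  refine finrank_add_one_eq inf_le_left hx (fun h => hf h.2) fun y hy =>
    ⟨f y * (f x)⁻¹, sub_mem hy (X.smul_mem _ hx), ?_⟩
  simp only [LinearMap.mem_ker, map_sub, map_smul, smul_eq_mul, SetLike.mem_coe]
  rw [mul_assoc, inv_mul_cancel₀ hf, mul_one, sub_self]

theorem exists_common_complement (X Y : Submodule K V) (h : finrank K X = finrank K Y) :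
    ∃ C, IsCompl X C ∧ IsCompl Y C := by
  induction hd : finrank K V - finrank K X generalizing X Y with
  | zero =>
    have hX : X = ⊤ := Submodule.eq_top_of_finrank_eq
      (le_antisymm (Submodule.finrank_le X) (by omega))
    have hY : Y = ⊤ := Submodule.eq_top_of_finrank_eq
      (le_antisymm (Submodule.finrank_le Y) (by omega))
    subst hX hY
    exact ⟨⊥, isCompl_top_bot, isCompl_top_bot⟩
  | succ d ih =>
    have hne : ∀ Z : Submodule K V, finrank K X = finrank K Z → ¬ ⊤ ≤ Z := by
      intro Z hZ hle
      rw [top_le_iff.1 hle, finrank_top] at hZ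
      omega
    obtain ⟨v, -, hvX, hvY⟩ := exists_mem_notMem_notMem (hne X rfl) (hne Y h)
    have hX := Submodule.finrank_sup_span_singleton hvX
    have hY := Submodule.finrank_sup_span_singleton hvY
    obtain ⟨C, hC, hC'⟩ := ih (X ⊔ K ∙ v) (Y ⊔ K ∙ v) (by omega) (by omega)
    refine ⟨(K ∙ v) ⊔ C, ⟨?_, ?_⟩, ⟨?_, ?_⟩⟩
    · exact (disjoint_span_of_notMem hvX).disjoint_sup_right_of_disjoint_sup_left hC.disjoint
    · rw [codisjoint_iff, ← sup_assoc]
      exact hC.sup_eq_top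
    · exact (disjoint_span_of_notMem hvY).disjoint_sup_right_of_disjoint_sup_left hC'.disjoint
    · rw [codisjoint_iff, ← sup_assoc]
      exact hC'.sup_eq_top

/-- Two spaces of equal dimension which both avoid `v` have a common complement
through `v`. -/
theorem exists_common_complement_mem {X Y : Submodule K V} (h : finrank K X = finrank K Y)
    {v : V} (hvX : v ∉ X) (hvY : v ∉ Y) : ∃ C, v ∈ C ∧ IsCompl C X ∧ IsCompl C Y := by
  have hX := Submodule.finrank_sup_span_singleton hvX
  have hY := Submodule.finrank_sup_span_singleton hvY
  obtain ⟨C, hC, hC'⟩ := exists_common_complement (X ⊔ K ∙ v) (Y ⊔ K ∙ v) (by omega)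
  refine ⟨(K ∙ v) ⊔ C, Submodule.mem_sup_left (Submodule.mem_span_singleton_self _),
    IsCompl.symm ⟨?_, ?_⟩, IsCompl.symm ⟨?_, ?_⟩⟩
  · exact (disjoint_span_of_notMem hvX).disjoint_sup_right_of_disjoint_sup_left hC.disjoint
  · rw [codisjoint_iff, ← sup_assoc]
    exact hC.sup_eq_top
  · exact (disjoint_span_of_notMem hvY).disjoint_sup_right_of_disjoint_sup_left hC'.disjoint
  · rw [codisjoint_iff, ← sup_assoc]
    exact hC'.sup_eq_top

end Subspaces

/-- The `n`-dimensional subspaces of `V`. -/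
abbrev Gr (K V : Type*) [DivisionRing K] [AddCommGroup V] [Module K V] (n : ℕ) :=
  {X : Submodule K V // finrank K X = n}

/-- Complementarity of `n`-dimensional subspaces. -/
def Opp {K V : Type*} [DivisionRing K] [AddCommGroup V] [Module K V] {n : ℕ}
    (X Y : Gr K V n) : Prop := IsCompl X.1 Y.1

section Grassmann

variable {K V : Type*} [DivisionRing K] [AddCommGroup V] [Module K V]
  [FiniteDimensional K V] {n : ℕ}

theorem Gr.not_le {X Y : Gr K V n} (h : X ≠ Y) : ¬ X.1 ≤ Y.1 := fun hle =>
  h (Subtype.ext (eq_of_le_of_finrank_eq hle (X.2.trans Y.2.symm)))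

theorem Gr.exists_opp (hV : finrank K V = 2 * n) (R : Gr K V n) {S : Submodule K V}
    (hS : Disjoint S R.1) : ∃ Z : Gr K V n, S ≤ Z.1 ∧ Opp Z R := by
  obtain ⟨C, hC, hC'⟩ := hS.exists_isCompl
  have := Submodule.finrank_add_eq_of_isCompl hC'
  exact ⟨⟨C, by have := R.2; omega⟩, hC, hC'⟩

theorem Gr.exists_opp_of_notMem (hV : finrank K V = 2 * n) (R : Gr K V n) {v : V}
    (hv : v ∉ R.1) : ∃ Z : Gr K V n, v ∈ Z.1 ∧ Opp Z R := by
  obtain ⟨Z, h1, h2⟩ := Gr.exists_opp hV R (disjoint_span_of_notMem hv).symm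
  exact ⟨Z, h1 (Submodule.mem_span_singleton_self _), h2⟩

theorem opp_iff_disjoint (hV : finrank K V = 2 * n) (X Y : Gr K V n) :
    Opp X Y ↔ Disjoint X.1 Y.1 :=
  ⟨fun h => h.disjoint, fun h => isCompl_of_disjoint h (by rw [X.2, Y.2]; omega)⟩

theorem exists_mem_of_not_opp (hV : finrank K V = 2 * n) {X Y : Gr K V n}
    (h : ¬ Opp X Y) : ∃ v ≠ 0, v ∈ X.1 ∧ v ∈ Y.1 := by
  rw [opp_iff_disjoint hV, Submodule.disjoint_def] at h
  push Not at h
  obtain ⟨v, h1, h2, h3⟩ := h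
  exact ⟨v, h3, h1, h2⟩

theorem Gr.finrank_inf_lt {X Y : Gr K V n} (h : X ≠ Y) :
    finrank K ↥(X.1 ⊓ Y.1) < n := by
  have hlt : X.1 ⊓ Y.1 < X.1 := inf_lt_left.2 (Gr.not_le h)
  simpa only [X.2] using Submodule.finrank_lt_finrank_of_lt hlt

theorem near_of_mem_pencil (hV : finrank K V = 2 * n) {X Y R : Gr K V n}
    (h : finrank K ↥(X.1 ⊓ Y.1) + 1 = n) (h1 : X.1 ⊓ Y.1 ≤ R.1) (h2 : R.1 ≤ X.1 ⊔ Y.1) :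
    Near Opp X Y R := by
  intro Z hZ
  by_contra hcon
  push Not at hcon
  obtain ⟨a, ha0, haZ, haX⟩ := exists_mem_of_not_opp hV hcon.1
  obtain ⟨b, hb0, hbZ, hbY⟩ := exists_mem_of_not_opp hV hcon.2
  set W := X.1 ⊔ Y.1 with hW
  have hWf := Submodule.finrank_sup_add_finrank_inf_eq X.1 Y.1
  have hd : Disjoint R.1 (Z.1 ⊓ W) := hZ.disjoint.symm.mono_right inf_le_left
  have hs := Submodule.finrank_sup_add_finrank_inf_eq R.1 (Z.1 ⊓ W)
  rw [hd.eq_bot, finrank_bot] at hs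
  have hle : finrank K ↥(R.1 ⊔ (Z.1 ⊓ W)) ≤ finrank K W :=
    Submodule.finrank_mono (sup_le h2 inf_le_right)
  rw [X.2, Y.2] at hWf
  rw [R.2] at hs
  have hX1 : finrank K W + finrank K ↥(X.1 ⊓ Y.1) = n + n := hWf
  have h3 : finrank K ↥(Z.1 ⊓ W) ≤ 1 := by omega
  have haW : a ∈ Z.1 ⊓ W := ⟨haZ, Submodule.mem_sup_left haX⟩
  have hbW : b ∈ Z.1 ⊓ W := ⟨hbZ, Submodule.mem_sup_right hbY⟩
  have h4 : K ∙ b = Z.1 ⊓ W := by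
    apply Submodule.eq_of_le_of_finrank_le
    · exact (Submodule.span_singleton_le_iff_mem _ _).2 hbW
    · rwa [finrank_span_singleton hb0]
  rw [← h4] at haW
  obtain ⟨c, rfl⟩ := Submodule.mem_span_singleton.1 haW
  exact not_isCompl_of_mem ha0 haZ (h1 ⟨haX, Y.1.smul_mem _ hbY⟩) hZ

theorem mem_pencil_of_near (hV : finrank K V = 2 * n) {X Y R : Gr K V n} (hX : R ≠ X)
    (hY : R ≠ Y) (h : Near Opp X Y R) :
    finrank K ↥(X.1 ⊓ Y.1) + 1 = n ∧ X.1 ⊓ Y.1 ≤ R.1 ∧ R.1 ≤ X.1 ⊔ Y.1 := by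
  have hXY : X.1 ⊓ Y.1 ≤ R.1 := by
    rintro w ⟨hwX, hwY⟩
    by_contra hwR
    obtain ⟨Z, hZ, hZR⟩ := Gr.exists_opp_of_notMem hV R hwR
    have hw0 : w ≠ 0 := fun h => hwR (h ▸ zero_mem _)
    exact (h Z hZR).elim (not_isCompl_of_mem hw0 hZ hwX) (not_isCompl_of_mem hw0 hZ hwY)
  have hdep : ∀ a ∈ X.1, a ∉ R.1 → ∀ b ∈ Y.1, b ∉ R.1 → ∃ t : K, b - t • a ∈ R.1 := by
    intro a haX haR b hbY hbR
    by_contra hcon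
    push Not at hcon
    have hd : Disjoint (Submodule.span K {a, b}) R.1 := by
      rw [Submodule.disjoint_def]
      intro x hx hxR
      obtain ⟨s, t, rfl⟩ := Submodule.mem_span_pair.1 hx
      by_cases ht : t = 0
      · subst ht
        by_cases hs : s = 0
        · simp [hs]
        · rw [zero_smul, add_zero, R.1.smul_mem_iff hs] at hxR
          exact absurd hxR haR
      · refine absurd ?_ (hcon (-(t⁻¹ * s)))
        have := R.1.smul_mem t⁻¹ hxR
        rw [smul_add, smul_smul, smul_smul, inv_mul_cancel₀ ht, one_smul] at this
        rwa [neg_smul, sub_neg_eq_add, add_comm]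
    obtain ⟨Z, hZ, hZR⟩ := Gr.exists_opp hV R hd
    have ha0 : a ≠ 0 := fun h => haR (h ▸ zero_mem _)
    have hb0 : b ≠ 0 := fun h => hbR (h ▸ zero_mem _)
    exact (h Z hZR).elim
      (not_isCompl_of_mem ha0 (hZ (Submodule.subset_span (by simp))) haX)
      (not_isCompl_of_mem hb0 (hZ (Submodule.subset_span (by simp))) hbY)
  obtain ⟨a, haX, haR⟩ := SetLike.not_le_iff_exists.1 (Gr.not_le hX.symm)
  obtain ⟨b, hbY, hbR, hba⟩ : ∃ b ∈ Y.1, b ∉ R.1 ∧ b - a ∈ R.1 := by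
    obtain ⟨b, hbY, hbR⟩ := SetLike.not_le_iff_exists.1 (Gr.not_le hY.symm)
    obtain ⟨t, ht⟩ := hdep a haX haR b hbY hbR
    have ht0 : t ≠ 0 := by
      rintro rfl
      exact hbR (by simpa using ht)
    have hti : t⁻¹ ≠ 0 := inv_ne_zero ht0
    refine ⟨t⁻¹ • b, Y.1.smul_mem _ hbY, by rwa [R.1.smul_mem_iff hti], ?_⟩
    have := R.1.smul_mem t⁻¹ ht
    rwa [smul_sub, smul_smul, inv_mul_cancel₀ ht0, one_smul] at this
  have hXf : finrank K ↥(X.1 ⊓ R.1) + 1 = n := by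
    refine (finrank_add_one_eq inf_le_left haX (fun h => haR h.2) fun x hx => ?_).trans X.2
    by_cases hxR : x ∈ R.1
    · exact ⟨0, by simpa using ⟨hx, hxR⟩⟩
    obtain ⟨t, ht⟩ := hdep x hx hxR b hbY hbR
    have hta : a - t • x ∈ R.1 := by
      have := sub_mem ht hba
      rwa [sub_sub_sub_cancel_left, ← neg_mem_iff, neg_sub, ← neg_mem_iff, neg_sub] at this
    have ht0 : t ≠ 0 := by
      rintro rfl
      exact haR (by simpa using hta)
    refine ⟨t⁻¹, sub_mem hx (X.1.smul_mem _ haX), ?_⟩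
    have := R.1.smul_mem (-t⁻¹) hta
    rwa [smul_sub, neg_smul, neg_smul, smul_smul, inv_mul_cancel₀ ht0, one_smul,
      sub_neg_eq_add, neg_add_eq_sub] at this
  have hYf : finrank K ↥(Y.1 ⊓ R.1) + 1 = n := by
    refine (finrank_add_one_eq inf_le_left hbY (fun h => hbR h.2) fun y hy => ?_).trans Y.2
    by_cases hyR : y ∈ R.1
    · exact ⟨0, by simpa using ⟨hy, hyR⟩⟩
    obtain ⟨t, ht⟩ := hdep a haX haR y hy hyR
    refine ⟨t, sub_mem hy (Y.1.smul_mem _ hbY), ?_⟩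
    have := sub_mem ht (R.1.smul_mem t hba)
    rwa [smul_sub, sub_sub_sub_cancel_right] at this
  have hPQ : X.1 ⊓ R.1 ≤ Y.1 ⊓ R.1 := by
    by_contra hne
    have hlt : Y.1 ⊓ R.1 < (X.1 ⊓ R.1) ⊔ (Y.1 ⊓ R.1) := right_lt_sup.2 hne
    have hlt' := Submodule.finrank_lt_finrank_of_lt hlt
    have heq : (X.1 ⊓ R.1) ⊔ (Y.1 ⊓ R.1) = R.1 := by
      apply Submodule.eq_of_le_of_finrank_le (sup_le inf_le_right inf_le_right)
      have := R.2
      omega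
    rw [← heq, Submodule.mem_sup] at hba
    obtain ⟨p, hp, q, hq, hpq⟩ := hba
    have hw : a + p = b - q := by
      rw [eq_sub_iff_add_eq, add_assoc, hpq]; abel
    have : a + p ∈ X.1 ⊓ Y.1 :=
      ⟨add_mem haX hp.1, by rw [hw]; exact sub_mem hbY hq.1⟩
    exact haR ((R.1.add_mem_iff_left hp.2).1 (hXY this))
  have heq : X.1 ⊓ Y.1 = X.1 ⊓ R.1 :=
    le_antisymm (le_inf inf_le_left hXY) (le_inf inf_le_left (hPQ.trans inf_le_left))
  refine ⟨heq ▸ hXf, hXY, ?_⟩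
  have hbaX : b - a ∉ X.1 ⊓ R.1 := fun h => hbR (hXY ⟨by
    have := add_mem h.1 haX
    rwa [sub_add_cancel] at this, hbY⟩)
  have hR : (X.1 ⊓ R.1) ⊔ (K ∙ (b - a)) = R.1 := by
    apply Submodule.eq_of_le_of_finrank_le
    · exact sup_le inf_le_right ((Submodule.span_singleton_le_iff_mem _ _).2 hba)
    · rw [Submodule.finrank_sup_span_singleton hbaX, hXf, R.2]
  rw [← hR]
  refine sup_le (inf_le_left.trans le_sup_left)
    ((Submodule.span_singleton_le_iff_mem _ _).2 ?_)
  exact sub_mem (Submodule.mem_sup_right hbY) (Submodule.mem_sup_left haX)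

theorem Gr.adj_iff (hV : finrank K V = 2 * n) (X Y : Gr K V n) :
    Adj Opp X Y ↔ finrank K ↥(X.1 ⊓ Y.1) + 1 = n := by
  constructor
  · rintro ⟨R, h1, h2, h3⟩
    exact (mem_pencil_of_near hV h1 h2 h3).1
  · intro h
    have hle : ∀ A B : Gr K V n, finrank K ↥(A.1 ⊓ B.1) + 1 = n → ¬ A.1 ≤ B.1 := by
      intro A B h hle
      rw [inf_eq_left.2 hle, A.2] at h
      omega
    obtain ⟨x, hxX, hxY⟩ := SetLike.not_le_iff_exists.1 (hle X Y h)
    obtain ⟨y, hyY, hyX⟩ := SetLike.not_le_iff_exists.1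
      (hle Y X (by rwa [inf_comm]))
    have hxy : x + y ∉ X.1 := fun h => hyX ((X.1.add_mem_iff_right hxX).1 h)
    have hxy' : x + y ∉ Y.1 := fun h => hxY ((Y.1.add_mem_iff_left hyY).1 h)
    have hm : x + y ∈ (X.1 ⊓ Y.1) ⊔ (K ∙ (x + y)) :=
      Submodule.mem_sup_right (Submodule.mem_span_singleton_self _)
    refine ⟨⟨(X.1 ⊓ Y.1) ⊔ (K ∙ (x + y)), ?_⟩, ?_, ?_, ?_⟩
    · rw [Submodule.finrank_sup_span_singleton fun h' => hxy (Submodule.mem_inf.1 h').1, h]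
    · intro h
      exact hxy ((congrArg Subtype.val h) ▸ hm)
    · intro h
      exact hxy' ((congrArg Subtype.val h) ▸ hm)
    · refine near_of_mem_pencil hV h le_sup_left (sup_le (inf_le_left.trans le_sup_left) ?_)
      rw [Submodule.span_singleton_le_iff_mem]
      exact add_mem (Submodule.mem_sup_left hxX) (Submodule.mem_sup_right hyY)

theorem Gr.adj_of_le (hV : finrank K V = 2 * n) {X Y : Gr K V n} (hne : X ≠ Y)
    (h : n ≤ finrank K ↥(X.1 ⊓ Y.1) + 1) : Adj Opp X Y := by
  rw [Gr.adj_iff hV]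
  have := Gr.finrank_inf_lt hne
  omega

theorem Gr.exists_adj_of_hyperplane (hV : finrank K V = 2 * n) (X : Gr K V n)
    {H : Submodule K V} (hH : H ≤ X.1) (hHn : finrank K H + 1 = n) {y : V}
    (hy : y ∉ X.1) : ∃ Y : Gr K V n, Y.1 = H ⊔ (K ∙ y) ∧ Adj Opp X Y := by
  refine ⟨⟨H ⊔ (K ∙ y), ?_⟩, rfl, Gr.adj_of_le hV ?_ ?_⟩
  · rw [Submodule.finrank_sup_span_singleton fun h => hy (hH h), hHn]
  · intro h
    apply hy
    rw [h]
    exact Submodule.mem_sup_right (Submodule.mem_span_singleton_self _)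
  · exact hHn.symm.le.trans
      (Nat.add_le_add_right (Submodule.finrank_mono (le_inf hH le_sup_left)) 1)

theorem Gr.isGeometry (hV : finrank K V = 2 * n) (hn : 1 ≤ n) :
    IsGeometry (Opp (K := K) (V := V) (n := n)) where
  eq_of_forall X R h := by
    by_contra hne
    obtain ⟨a, haX, haR⟩ := SetLike.not_le_iff_exists.1 (Gr.not_le (Ne.symm hne))
    obtain ⟨Z, hZ, hZR⟩ := Gr.exists_opp_of_notMem hV R haR
    exact not_isCompl_of_mem (ne_of_mem_of_not_mem (zero_mem _) haR).symm hZ haX (h Z hZR)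
  exists_distant X := by
    obtain ⟨Z, -, hZ⟩ := Gr.exists_opp hV X (disjoint_bot_left)
    exact ⟨Z, hZ⟩
  exists_adj X := by
    have h0 : ¬ X.1 ≤ ⊥ := fun h => by
      have := X.2
      rw [le_bot_iff.1 h, finrank_bot] at this
      omega
    have h1 : ¬ ⊤ ≤ X.1 := fun h => by
      have := X.2
      rw [top_le_iff.1 h, finrank_top] at this
      omega
    obtain ⟨H, -, hH, hHf⟩ := exists_hyperplane bot_le h0
    obtain ⟨y, -, hy⟩ := SetLike.not_le_iff_exists.1 h1
    obtain ⟨Y, -, hY⟩ := Gr.exists_adj_of_hyperplane hV X hH (hHf.trans X.2) hy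
    exact ⟨Y, hY⟩
  local_connected p q q' h h' := by
    rw [Gr.adj_iff hV] at h h'
    have hq' : ¬ q'.1 ≤ p.1 := fun hle => by
      rw [inf_eq_right.2 hle, q'.2] at h'
      omega
    obtain ⟨z, hzq, hzp⟩ := SetLike.not_le_iff_exists.1 hq'
    obtain ⟨s, hs, hps⟩ := Gr.exists_adj_of_hyperplane hV p inf_le_left h hzp
    have hzs : z ∈ s.1 := by
      rw [hs]
      exact Submodule.mem_sup_right (Submodule.mem_span_singleton_self _)
    have hHs : p.1 ⊓ q.1 ≤ s.1 := by rw [hs]; exact le_sup_left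
    refine ⟨s, hps, ?_, ?_⟩
    · by_cases hsq : s = q
      · exact Or.inl hsq
      · right
        refine Gr.adj_of_le hV hsq ?_
        exact h.symm.le.trans
          (Nat.add_le_add_right (Submodule.finrank_mono (le_inf hHs inf_le_right)) 1)
    · by_cases hsq : s = q'
      · exact Or.inl hsq
      · right
        refine Gr.adj_of_le hV hsq ?_
        have h1 := Submodule.finrank_sup_add_finrank_inf_eq (p.1 ⊓ q.1) (p.1 ⊓ q'.1)
        have h2 : finrank K ↥((p.1 ⊓ q.1) ⊔ (p.1 ⊓ q'.1)) ≤ n :=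
          (Submodule.finrank_mono (sup_le inf_le_left inf_le_left)).trans_eq p.2
        have h3 : z ∉ (p.1 ⊓ q.1) ⊓ (p.1 ⊓ q'.1) := fun h => hzp h.1.1
        have h4 := Submodule.finrank_sup_span_singleton h3
        have h5 : ((p.1 ⊓ q.1) ⊓ (p.1 ⊓ q'.1)) ⊔ (K ∙ z) ≤ s.1 ⊓ q'.1 :=
          sup_le (le_inf (inf_le_left.trans hHs) (inf_le_right.trans inf_le_right))
            ((Submodule.span_singleton_le_iff_mem _ _).2 ⟨hzs, hzq⟩)
        have h6 := Submodule.finrank_mono h5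
        omega
  connected p q := by
    induction hd : n - finrank K ↥(p.1 ⊓ q.1) using Nat.strong_induction_on
      generalizing p with
    | _ d ih =>
      by_cases hpq : p = q
      · rw [hpq]
      · have hlt := Gr.finrank_inf_lt hpq
        obtain ⟨y, hyq, hyp⟩ := SetLike.not_le_iff_exists.1 (Gr.not_le (Ne.symm hpq))
        obtain ⟨H, hH, hHp, hHf⟩ := exists_hyperplane (inf_le_left : p.1 ⊓ q.1 ≤ p.1)
          (fun h => Gr.not_le hpq (h.trans inf_le_right))
        obtain ⟨s, hs, hps⟩ := Gr.exists_adj_of_hyperplane hV p hHp (hHf.trans p.2) hyp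
        have h1 : y ∉ p.1 ⊓ q.1 := fun h => hyp h.1
        have h2 := Submodule.finrank_sup_span_singleton h1
        have h3 : (p.1 ⊓ q.1) ⊔ (K ∙ y) ≤ s.1 ⊓ q.1 := by
          rw [hs]
          exact sup_le (le_inf (hH.trans le_sup_left) inf_le_right)
            ((Submodule.span_singleton_le_iff_mem _ _).2
              ⟨Submodule.mem_sup_right (Submodule.mem_span_singleton_self _), hyq⟩)
        have h4 := Submodule.finrank_mono h3
        exact Relation.ReflTransGen.head hps (ih _ (by omega) s rfl)

theorem Gr.eq_of_opp_iff_of_ne {A X X' : Gr K V n}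
    (h : ∀ Z : Gr K V n, Opp Z A → (Opp Z X ↔ Opp Z X')) (hV : finrank K V = 2 * n)
    (hne : X ≠ X') : X' = A := by
  by_contra hA
  obtain ⟨z, hz, hzX, hzA⟩ := exists_mem_notMem_notMem (Gr.not_le hne.symm) (Gr.not_le hA)
  obtain ⟨C, hzC, hCX, hCA⟩ := exists_common_complement_mem (X.2.trans A.2.symm) hzX hzA
  have := Submodule.finrank_add_eq_of_isCompl hCX
  refine not_isCompl_of_mem (ne_of_mem_of_not_mem (zero_mem _) hzX).symm hzC hz
    ((h ⟨C, by have := X.2; omega⟩ hCA).1 hCX)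

/-- A subspace is determined by its complements among the complements of a fixed one. -/
theorem Gr.eq_of_opp_iff {A X X' : Gr K V n} (hV : finrank K V = 2 * n)
    (h : ∀ Z : Gr K V n, Opp Z A → (Opp Z X ↔ Opp Z X')) : X = X' := by
  by_contra hne
  exact hne ((Gr.eq_of_opp_iff_of_ne (fun Z hZ => (h Z hZ).symm) hV (Ne.symm hne)).trans
    (Gr.eq_of_opp_iff_of_ne h hV hne).symm)

end Grassmann

section RankOne

variable {R : Type*} [Ring R]

/-- A ring-theoretic description of the elements of rank one of an endomorphism ring. -/
def IsRankOne (x : R) : Prop :=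
  x ≠ 0 ∧ ∀ a b, a * x * b ≠ 0 → ∃ s t, s * (a * x * b) * t = x

/-- `y` is a left multiple of `x`. -/
def LeftMul (x y : R) : Prop := ∃ r, y = r * x

/-- `y` is a right multiple of `x`. -/
def RightMul (x y : R) : Prop := ∃ r, y = x * r

end RankOne

section Functionals

variable {K U : Type*} [DivisionRing K] [AddCommGroup U] [Module K U]

theorem exists_functional_eq_one_of_notMem {P : Submodule K U} {u : U} (hu : u ∉ P) :
    ∃ g : U →ₗ[K] K, g u = 1 ∧ P ≤ LinearMap.ker g := by
  obtain ⟨f, hf, hP⟩ := Submodule.exists_le_ker_of_notMem hu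
  refine ⟨f.smulRight (f u)⁻¹, by simp [hf], fun x hx => ?_⟩
  have := hP hx
  rw [LinearMap.mem_ker] at this ⊢
  simp [this]

theorem exists_functional_eq_one {u : U} (hu : u ≠ 0) : ∃ g : U →ₗ[K] K, g u = 1 := by
  obtain ⟨g, hg, -⟩ := exists_functional_eq_one_of_notMem
    (K := K) (P := ⊥) (u := u) (by simpa using hu)
  exact ⟨g, hg⟩

theorem exists_apply_eq_one {h : U →ₗ[K] K} (hh : h ≠ 0) : ∃ u, h u = 1 := by
  obtain ⟨w, hw⟩ : ∃ w, h w ≠ 0 := by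
    by_contra hcon
    push Not at hcon
    exact hh (LinearMap.ext hcon)
  exact ⟨(h w)⁻¹ • w, by simp [hw]⟩

theorem exists_functional_separating {P : Submodule K U} {x y : U} (h : x - y ∉ P) :
    ∃ k : U →ₗ[K] K, P ≤ LinearMap.ker k ∧ ¬ (k x = 1 ↔ k y = 1) := by
  obtain ⟨f, hf, hP⟩ := Submodule.exists_le_ker_of_notMem h
  rw [map_sub, sub_ne_zero] at hf
  have hle : ∀ c : K, P ≤ LinearMap.ker (f.smulRight c) := fun c z hz => by
    have := hP hz
    rw [LinearMap.mem_ker] at this ⊢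
    simp [this]
  by_cases hx : f x = 0
  · have hy : f y ≠ 0 := fun h => hf (hx.trans h.symm)
    refine ⟨f.smulRight (f y)⁻¹, hle _, ?_⟩
    simp [hx, hy]
  · refine ⟨f.smulRight (f x)⁻¹, hle _, ?_⟩
    simp only [LinearMap.smulRight_apply, smul_eq_mul, mul_inv_cancel₀ hx, true_iff]
    intro h
    exact hf (eq_of_mul_inv_eq_one h).symm

theorem smulRight_eq_zero_iff {h : U →ₗ[K] K} {u : U} :
    h.smulRight u = 0 ↔ h = 0 ∨ u = 0 := by
  constructor
  · intro h0
    by_contra hcon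
    push Not at hcon
    obtain ⟨w, hw⟩ := exists_apply_eq_one hcon.1
    exact hcon.2 (by simpa [hw] using LinearMap.congr_fun h0 w)
  · rintro (rfl | rfl) <;> ext <;> simp

theorem smulRight_left_inj {h : U →ₗ[K] K} (hh : h ≠ 0) {u v : U}
    (huv : h.smulRight u = h.smulRight v) : u = v := by
  obtain ⟨w, hw⟩ := exists_apply_eq_one hh
  simpa [hw] using LinearMap.congr_fun huv w

theorem smulRight_right_inj {h k : U →ₗ[K] K} {u : U} (hu : u ≠ 0)
    (hhk : h.smulRight u = k.smulRight u) : h = k := by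
  ext w
  have := LinearMap.congr_fun hhk w
  simp only [LinearMap.smulRight_apply] at this
  exact smul_left_injective K hu this

theorem isRankOne_iff (x : Module.End K U) :
    IsRankOne x ↔ ∃ (h : U →ₗ[K] K) (u : U), h ≠ 0 ∧ u ≠ 0 ∧ x = h.smulRight u := by
  constructor
  · rintro ⟨hx, hx'⟩
    obtain ⟨w, hw⟩ : ∃ w, x w ≠ 0 := by
      by_contra hcon
      push Not at hcon
      exact hx (LinearMap.ext hcon)
    have hw0 : w ≠ 0 := by
      rintro rfl
      exact hw (map_zero x)
    obtain ⟨f, hf⟩ := exists_functional_eq_one (K := K) hw0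
    obtain ⟨s, t, hst⟩ := hx' 1 (f.smulRight w) fun h => hw (by
      simpa [hf] using LinearMap.congr_fun h w)
    have hxe : x = (f ∘ₗ t).smulRight (s (x w)) := by
      ext z
      simpa using (LinearMap.congr_fun hst z).symm
    refine ⟨f ∘ₗ t, s (x w), ?_, ?_, hxe⟩
    · intro h
      rw [h] at hxe
      exact hx (by rw [hxe, smulRight_eq_zero_iff]; exact Or.inl rfl)
    · intro h
      rw [h] at hxe
      exact hx (by rw [hxe, smulRight_eq_zero_iff]; exact Or.inr rfl)
  · rintro ⟨h, u, hh, hu, rfl⟩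
    refine ⟨fun h0 => (smulRight_eq_zero_iff.1 h0).elim hh hu, fun a b hab => ?_⟩
    have he : a * h.smulRight u * b = (h ∘ₗ b).smulRight (a u) := by
      ext z; simp
    rw [he] at hab ⊢
    rw [Ne, smulRight_eq_zero_iff, not_or] at hab
    obtain ⟨w, hw⟩ := exists_apply_eq_one hab.1
    obtain ⟨g, hg⟩ := exists_functional_eq_one (K := K) hab.2
    refine ⟨g.smulRight u, h.smulRight w, ?_⟩
    ext z
    simp only [LinearMap.comp_apply] at hw
    simp [hg, hw]

theorem isRankOne_smulRight {h : U →ₗ[K] K} {u : U} (hh : h ≠ 0) (hu : u ≠ 0) :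
    IsRankOne (R := Module.End K U) (h.smulRight u) :=
  (isRankOne_iff _).2 ⟨h, u, hh, hu, rfl⟩

theorem leftMul_smulRight_iff {h : U →ₗ[K] K} {u : U} (hu : u ≠ 0) (y : Module.End K U) :
    LeftMul (R := Module.End K U) (h.smulRight u) y ↔ ∃ v, y = h.smulRight v := by
  constructor
  · rintro ⟨r, rfl⟩
    exact ⟨r u, by ext z; simp⟩
  · rintro ⟨v, rfl⟩
    obtain ⟨g, hg⟩ := exists_functional_eq_one (K := K) hu
    exact ⟨g.smulRight v, by ext z; simp [hg]⟩

theorem rightMul_smulRight_iff {h : U →ₗ[K] K} {u : U} (hh : h ≠ 0) (y : Module.End K U) :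
    RightMul (R := Module.End K U) (h.smulRight u) y ↔ ∃ k : U →ₗ[K] K, y = k.smulRight u := by
  constructor
  · rintro ⟨r, rfl⟩
    exact ⟨h ∘ₗ r, by ext z; simp⟩
  · rintro ⟨k, rfl⟩
    obtain ⟨w, hw⟩ := exists_apply_eq_one hh
    exact ⟨k.smulRight w, by ext z; simp [hw]⟩

theorem rightMul_smulRight_smulRight_iff {h k : U →ₗ[K] K} {u v : U} (hh : h ≠ 0)
    (hk : k ≠ 0) :
    RightMul (R := Module.End K U) (h.smulRight u) (k.smulRight v) ↔
      v ∈ Submodule.span K {u} := by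
  rw [rightMul_smulRight_iff hh, Submodule.mem_span_singleton]
  constructor
  · rintro ⟨l, hl⟩
    obtain ⟨w, hw⟩ := exists_apply_eq_one hk
    have := LinearMap.congr_fun hl w
    simp only [LinearMap.smulRight_apply, hw, one_smul] at this
    exact ⟨_, this.symm⟩
  · rintro ⟨c, rfl⟩
    exact ⟨k.smulRight c, by ext z; simp [mul_smul]⟩

theorem isUnit_one_sub_smulRight_iff [FiniteDimensional K U] (h : U →ₗ[K] K) (w : U) :
    IsUnit (1 - h.smulRight w : Module.End K U) ↔ h w ≠ 1 := by
  rw [LinearMap.isUnit_iff_ker_eq_bot, LinearMap.ker_eq_bot']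
  constructor
  · intro hker hw
    have hw0 : w = 0 := hker w (by simp [hw])
    simp [hw0] at hw
  · intro hw v hv
    simp only [LinearMap.sub_apply, Module.End.one_apply, LinearMap.smulRight_apply,
      sub_eq_zero] at hv
    by_contra hv0
    have h1 : h v ≠ 0 := fun h0 => hv0 (by rw [hv, h0, zero_smul])
    have h2 : h v = h v * h w := by
      conv_lhs => rw [hv]
      simp
    exact hw (mul_left_cancel₀ h1 (by rw [← h2, mul_one]))

end Functionals

section Semilinear

variable {K U K' U' : Type*} [DivisionRing K] [AddCommGroup U] [Module K U]
  [DivisionRing K'] [AddCommGroup U'] [Module K' U'] {s : U → U'}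

theorem exists_notMem_span_singleton (hdim : 1 < finrank K U) (u : U) :
    ∃ w, w ∉ Submodule.span K {u} := by
  by_contra hcon
  push Not at hcon
  exact absurd (finrank_le_one u fun w => Submodule.mem_span_singleton.1 (hcon w))
    (not_le.2 hdim)

theorem sub_mem_span_of_functionals
    (hs : ∀ u, u ≠ 0 → ∀ v, v ∈ Submodule.span K {u} ↔ s v ∈ Submodule.span K' {s u})
    (hk : ∀ k' : U' →ₗ[K'] K', ∃ k : U →ₗ[K] K, ∀ u, k u = 1 ↔ k' (s u) = 1)
    (u : U) {v : U} (hv : v ≠ 0) : s (u + v) - s u ∈ Submodule.span K' {s v} := by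
  by_contra hcon
  obtain ⟨k', hk', hne⟩ := exists_functional_separating hcon
  obtain ⟨k, hkk⟩ := hk k'
  have hkv : k v = 0 := by
    by_contra h0
    have h1 : k ((k v)⁻¹ • v) = 1 := by simp [h0]
    rw [hkk] at h1
    have h2 : s ((k v)⁻¹ • v) ∈ Submodule.span K' {s v} :=
      (hs v hv _).1 (Submodule.smul_mem _ _ (Submodule.mem_span_singleton_self v))
    rw [LinearMap.mem_ker.1 (hk' h2)] at h1
    exact zero_ne_one h1
  rw [← hkk, ← hkk, map_add, hkv, add_zero] at hne
  exact hne Iff.rfl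

/-- A bijection which respects dependence and the equations `k u = 1` is additive. -/
theorem map_add_of_functionals (hdim : 1 < finrank K U) (h0 : s 0 = 0)
    (hs : ∀ u, u ≠ 0 → ∀ v, v ∈ Submodule.span K {u} ↔ s v ∈ Submodule.span K' {s u})
    (hk : ∀ k' : U' →ₗ[K'] K', ∃ k : U →ₗ[K] K, ∀ u, k u = 1 ↔ k' (s u) = 1)
    (u v : U) : s (u + v) = s u + s v := by
  have key : ∀ u v, v ∉ Submodule.span K {u} → s (u + v) = s u + s v := by
    intro u v huv
    by_cases hu : u = 0
    · simp [hu, h0]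
    have hv : v ≠ 0 := by
      rintro rfl
      exact huv (zero_mem _)
    obtain ⟨b, hb⟩ := Submodule.mem_span_singleton.1 (sub_mem_span_of_functionals hs hk u hv)
    obtain ⟨a, ha⟩ := Submodule.mem_span_singleton.1 (sub_mem_span_of_functionals hs hk v hu)
    rw [add_comm v u] at ha
    rw [hs u hu] at huv
    by_cases hb1 : b = 1
    · rw [hb1, one_smul] at hb
      rw [hb]; abel
    · exfalso
      have h1 : (1 - b) • s v = (1 - a) • s u := by
        rw [sub_smul, sub_smul, ha, hb]; simp only [one_smul]; abel
      have h2 : (1 - b) • s v ∈ Submodule.span K' {s u} := by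
        rw [h1]
        exact Submodule.smul_mem _ _ (Submodule.mem_span_singleton_self _)
      exact huv ((Submodule.smul_mem_iff _ (sub_ne_zero.2 (Ne.symm hb1))).1 h2)
  by_cases huv : v ∈ Submodule.span K {u}
  · by_cases hv : v = 0
    · simp [hv, h0]
    obtain ⟨w, hw⟩ := exists_notMem_span_singleton hdim u
    have hle : Submodule.span K {v} ≤ Submodule.span K {u} :=
      (Submodule.span_singleton_le_iff_mem _ _).2 huv
    have hle' : Submodule.span K {u + v} ≤ Submodule.span K {u} :=
      (Submodule.span_singleton_le_iff_mem _ _).2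
        (add_mem (Submodule.mem_span_singleton_self u) huv)
    have h1 := key (u + v) w fun h => hw (hle' h)
    have h2 := key u (v + w) fun h => hw ((Submodule.add_mem_iff_right _ huv).1 h)
    have h3 := key v w fun h => hw (hle h)
    rw [h3, ← add_assoc, h1, ← add_assoc] at h2
    exact add_right_cancel h2
  · exact key u v huv

theorem exists_smul_eq_of_mem_span (hdim : 1 < finrank K U) {s₁ : U → U'}
    (hs : ∀ u, u ≠ 0 → ∀ v, v ∈ Submodule.span K {u} ↔ s v ∈ Submodule.span K' {s u})
    (hadd : ∀ u v, s (u + v) = s u + s v) (hadd₁ : ∀ u v, s₁ (u + v) = s₁ u + s₁ v)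
    (h : ∀ u, s₁ u ∈ Submodule.span K' {s u}) (hs0 : ∀ u, s u = 0 → u = 0) :
    ∃ c : K', ∀ u, s₁ u = c • s u := by
  choose c hc using fun u => Submodule.mem_span_singleton.1 (h u)
  have key : ∀ u v, u ≠ 0 → v ∉ Submodule.span K {u} → c u = c v := by
    intro u v hu huv
    have hsv := (hs u hu v).not.1 huv
    have hsu : s u ≠ 0 := fun h => hu (hs0 u h)
    have h1 := hadd₁ u v
    rw [← hc, ← hc u, ← hc v, hadd, smul_add] at h1
    have h2 : (c (u + v) - c v) • s v = (c u - c (u + v)) • s u := by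
      rw [sub_smul, sub_smul, sub_eq_sub_iff_add_eq_add, add_comm, h1]
    have h3 : c (u + v) = c v := by
      by_contra hne
      have h4 : (c (u + v) - c v) • s v ∈ Submodule.span K' {s u} := by
        rw [h2]
        exact Submodule.smul_mem _ _ (Submodule.mem_span_singleton_self _)
      exact hsv ((Submodule.smul_mem_iff _ (sub_ne_zero.2 hne)).1 h4)
    rw [h3, sub_self, zero_smul] at h2
    have h4 := (smul_eq_zero.1 h2.symm).resolve_right hsu
    exact sub_eq_zero.1 h4
  obtain ⟨u, hu⟩ := exists_notMem_span_singleton hdim (0 : U)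
  have hu0 : u ≠ 0 := by
    rintro rfl
    exact hu (zero_mem _)
  obtain ⟨w, hw⟩ := exists_notMem_span_singleton hdim u
  refine ⟨c u, fun v => ?_⟩
  by_cases hv0 : v = 0
  · subst hv0
    have h0 : s 0 = 0 := by simpa using hadd 0 0
    have h1 : s₁ 0 = 0 := by simpa using hadd₁ 0 0
    rw [h0, h1, smul_zero]
  by_cases hv : v ∈ Submodule.span K {u}
  · have hle : Submodule.span K {v} ≤ Submodule.span K {u} :=
      (Submodule.span_singleton_le_iff_mem _ _).2 hv
    rw [key u w hu0 hw, ← key v w hv0 fun h => hw (hle h), hc]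
  · rw [key u v hu0 hv, hc]

end Semilinear

/-- A pair of bijections `α, η` of rings linked by the invertibility of `1 - c * x`, where
`η` respects rank one elements and their left and right multiples. -/
structure Compat {R R' : Type*} [Ring R] [Ring R'] (α η : R → R') : Prop where
  surj_left : Function.Surjective α
  bij_right : Function.Bijective η
  map_zero : η 0 = 0
  map_one : α 1 = 1
  isUnit_iff : ∀ c x, IsUnit (1 - c * x) ↔ IsUnit (1 - α c * η x)
  isRankOne_iff : ∀ x, IsRankOne x ↔ IsRankOne (η x)
  leftMul_iff : ∀ x y, IsRankOne x → IsRankOne y → (LeftMul x y ↔ LeftMul (η x) (η y))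
  rightMul_iff : ∀ x y, IsRankOne x → IsRankOne y → (RightMul x y ↔ RightMul (η x) (η y))

section End

variable {K U K' U' : Type*} [DivisionRing K] [AddCommGroup U] [Module K U]
  [DivisionRing K'] [AddCommGroup U'] [Module K' U']
  {α η : Module.End K U → Module.End K' U'}

theorem Compat.exists_of_functional (hc : Compat α η) (hdim : 1 < finrank K U)
    {h : U →ₗ[K] K} (hh : h ≠ 0) :
    ∃ (s : U → U') (h' : U' →ₗ[K'] K'), h' ≠ 0 ∧ Function.Bijective s ∧ s 0 = 0 ∧
      (∀ u, η (h.smulRight u) = h'.smulRight (s u)) ∧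
      (∀ u, u ≠ 0 → ∀ v, v ∈ Submodule.span K {u} ↔ s v ∈ Submodule.span K' {s u}) := by
  obtain ⟨u₀, hu₀⟩ := exists_notMem_span_singleton hdim (0 : U)
  have hu₀ : u₀ ≠ 0 := by
    rintro rfl
    exact hu₀ (zero_mem _)
  have hr : ∀ u, u ≠ 0 → IsRankOne (R := Module.End K U) (h.smulRight u) := fun u hu =>
    isRankOne_smulRight hh hu
  obtain ⟨h', u₀', hh', hu₀', he⟩ :=
    (DistantGeometry.isRankOne_iff _).1 ((hc.isRankOne_iff _).1 (hr u₀ hu₀))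
  have hex : ∀ u, ∃ u', η (h.smulRight u) = h'.smulRight u' := by
    intro u
    by_cases hu : u = 0
    · refine ⟨0, ?_⟩
      rw [smulRight_eq_zero_iff.2 (Or.inr hu), smulRight_eq_zero_iff.2 (Or.inr rfl),
        hc.map_zero]
    · rw [← leftMul_smulRight_iff hu₀', ← he, ← hc.leftMul_iff _ _ (hr _ hu₀) (hr _ hu)]
      exact (leftMul_smulRight_iff hu₀ _).2 ⟨u, rfl⟩
  choose s hs using hex
  have hs0 : s 0 = 0 := by
    have h1 := hs 0
    rw [smulRight_eq_zero_iff.2 (Or.inr rfl), hc.map_zero, eq_comm,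
      smulRight_eq_zero_iff] at h1
    exact h1.resolve_left hh'
  have hinj : Function.Injective s := by
    intro u v huv
    refine smulRight_left_inj hh (hc.bij_right.1 ?_)
    rw [hs, hs, huv]
  have hne : ∀ u, u ≠ 0 → s u ≠ 0 := fun u hu h => hu (hinj (h.trans hs0.symm))
  refine ⟨s, h', hh', ⟨hinj, fun u' => ?_⟩, hs0, hs, fun u hu v => ?_⟩
  · by_cases hu' : u' = 0
    · exact ⟨0, hs0.trans hu'.symm⟩
    obtain ⟨y, hy⟩ := hc.bij_right.2 (h'.smulRight u')
    have hyr : IsRankOne y := by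
      rw [hc.isRankOne_iff, hy]
      exact isRankOne_smulRight hh' hu'
    have h1 : LeftMul (R := Module.End K U) (h.smulRight u₀) y := by
      rw [hc.leftMul_iff _ _ (hr _ hu₀) hyr, hy, he]
      exact (leftMul_smulRight_iff hu₀' _).2 ⟨u', rfl⟩
    obtain ⟨u, rfl⟩ := (leftMul_smulRight_iff hu₀ _).1 h1
    exact ⟨u, smulRight_left_inj hh' ((hs u).symm.trans hy)⟩
  · by_cases hv : v = 0
    · simp [hv, hs0]
    · rw [← rightMul_smulRight_smulRight_iff hh hh, hc.rightMul_iff _ _ (hr _ hu) (hr _ hv),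
        hs, hs, rightMul_smulRight_smulRight_iff hh' hh']

variable [FiniteDimensional K U] [FiniteDimensional K' U']

theorem Compat.apply_eq_one_iff (hc : Compat α η) {h : U →ₗ[K] K} {u : U}
    {h' : U' →ₗ[K'] K'} {u' : U'} (he : η (h.smulRight u) = h'.smulRight u')
    (c : Module.End K U) : h (c u) = 1 ↔ h' (α c u') = 1 := by
  have h1 := hc.isUnit_iff c (h.smulRight u)
  have h2 : c * h.smulRight u = h.smulRight (c u) := by ext; simp
  have h3 : α c * h'.smulRight u' = h'.smulRight (α c u') := by ext; simp
  rw [he, h2, h3, isUnit_one_sub_smulRight_iff, isUnit_one_sub_smulRight_iff] at h1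
  exact not_iff_not.1 h1

theorem Compat.exists_functional (hc : Compat α η) {h : U →ₗ[K] K} {h' : U' →ₗ[K'] K'}
    {s : U → U'} (hh' : h' ≠ 0) (hs : ∀ u, η (h.smulRight u) = h'.smulRight (s u))
    (k' : U' →ₗ[K'] K') : ∃ k : U →ₗ[K] K, ∀ u, k u = 1 ↔ k' (s u) = 1 := by
  obtain ⟨w, hw⟩ := exists_apply_eq_one hh'
  obtain ⟨c, hcc⟩ := hc.surj_left (k'.smulRight w)
  refine ⟨h ∘ₗ c, fun u => ?_⟩
  rw [LinearMap.comp_apply, hc.apply_eq_one_iff (hs u), hcc]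
  simp [hw]

theorem Compat.map_add_and_map_mul_end (hc : Compat α η) (hdim : 1 < finrank K U) :
    (∀ x y, α (x + y) = α x + α y) ∧ ∀ x y, α (x * y) = α x * α y := by
  obtain ⟨u₀, hu₀⟩ := exists_notMem_span_singleton hdim (0 : U)
  have hu₀ : u₀ ≠ 0 := by
    rintro rfl
    exact hu₀ (zero_mem _)
  obtain ⟨h₀, hh₀⟩ := exists_functional_eq_one (K := K) hu₀
  have hh₀ : h₀ ≠ 0 := by
    rintro rfl
    simp at hh₀
  obtain ⟨s, h₀', hh₀', hsb, hs0, hs, hsp⟩ := hc.exists_of_functional hdim hh₀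
  have hadd := map_add_of_functionals hdim hs0 hsp (hc.exists_functional hh₀' hs)
  have hne : ∀ u, u ≠ 0 → s u ≠ 0 := fun u hu h => hu (hsb.1 (h.trans hs0.symm))
  have ht : ∀ h : U →ₗ[K] K, ∃ h' : U' →ₗ[K'] K',
      ∀ u, η (h.smulRight u) = h'.smulRight (s u) := by
    intro h
    by_cases hh : h = 0
    · refine ⟨0, fun u => ?_⟩
      rw [smulRight_eq_zero_iff.2 (Or.inl hh), smulRight_eq_zero_iff.2 (Or.inl rfl),
        hc.map_zero]
    obtain ⟨s₁, h', hh', hsb₁, hs0₁, hs₁, hsp₁⟩ := hc.exists_of_functional hdim hh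
    have hadd₁ := map_add_of_functionals hdim hs0₁ hsp₁ (hc.exists_functional hh' hs₁)
    obtain ⟨c, hcs⟩ := exists_smul_eq_of_mem_span hdim hsp hadd hadd₁ (fun u => by
      by_cases hu : u = 0
      · rw [hu, hs0₁]; exact zero_mem _
      · rw [← rightMul_smulRight_smulRight_iff hh₀' hh', ← hs, ← hs₁,
          ← hc.rightMul_iff _ _ (isRankOne_smulRight hh₀ hu) (isRankOne_smulRight hh hu),
          rightMul_smulRight_smulRight_iff hh₀ hh]
        exact Submodule.mem_span_singleton_self u) (fun u hu => hsb.1 (hu.trans hs0.symm))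
    refine ⟨h'.smulRight c, fun u => ?_⟩
    rw [hs₁, hcs]
    ext z
    simp [mul_smul]
  choose t ht using ht
  have htsurj : Function.Surjective t := by
    intro k'
    by_cases hk' : k' = 0
    · refine ⟨0, smulRight_right_inj (hne u₀ hu₀) ?_⟩
      rw [← ht, smulRight_eq_zero_iff.2 (Or.inl rfl), hc.map_zero, eq_comm,
        smulRight_eq_zero_iff]
      exact Or.inl hk'
    obtain ⟨y, hy⟩ := hc.bij_right.2 (k'.smulRight (s u₀))
    have hyr : IsRankOne y := by
      rw [hc.isRankOne_iff, hy]
      exact isRankOne_smulRight hk' (hne u₀ hu₀)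
    have h1 : RightMul (R := Module.End K U) (h₀.smulRight u₀) y := by
      rw [hc.rightMul_iff _ _ (isRankOne_smulRight hh₀ hu₀) hyr, hy, hs]
      exact (rightMul_smulRight_iff hh₀' _).2 ⟨k', rfl⟩
    obtain ⟨k, rfl⟩ := (rightMul_smulRight_iff hh₀ _).1 h1
    exact ⟨k, smulRight_right_inj (hne u₀ hu₀) ((ht k u₀).symm.trans hy)⟩
  have hid : ∀ (h : U →ₗ[K] K) u, h u = 1 ↔ t h (s u) = 1 := by
    intro h u
    simpa [hc.map_one] using hc.apply_eq_one_iff (ht h u) 1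
  have hα : ∀ c u, α c (s u) = s (c u) := by
    intro c u
    by_contra hcon
    obtain ⟨k', -, hk'⟩ := exists_functional_separating
      (K := K') (P := ⊥) (x := α c (s u)) (y := s (c u)) (by simpa [sub_eq_zero] using hcon)
    obtain ⟨h, rfl⟩ := htsurj k'
    exact hk' ((hc.apply_eq_one_iff (ht h u) c).symm.trans (hid h (c u)))
  refine ⟨fun x y => ?_, fun x y => ?_⟩ <;>
  · ext u'
    obtain ⟨u, rfl⟩ := hsb.2 u'
    simp [hα, hadd]

end End

section Transport

variable {R S : Type*} [Ring R] [Ring S]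

theorem IsRankOne.map {x : R} (hx : IsRankOne x) (e : R ≃+* S) : IsRankOne (e x) := by
  refine ⟨(map_ne_zero_iff e e.injective).2 hx.1, fun a b hab => ?_⟩
  obtain ⟨a, rfl⟩ := e.surjective a
  obtain ⟨b, rfl⟩ := e.surjective b
  rw [← map_mul, ← map_mul, map_ne_zero_iff e e.injective] at hab
  obtain ⟨s, t, hst⟩ := hx.2 a b hab
  exact ⟨e s, e t, by simpa using congrArg e hst⟩

theorem isRankOne_map_iff (e : R ≃+* S) (x : R) : IsRankOne (e x) ↔ IsRankOne x :=
  ⟨fun h => by simpa using h.map e.symm, fun h => h.map e⟩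

theorem leftMul_map_iff (e : R ≃+* S) (x y : R) : LeftMul (e x) (e y) ↔ LeftMul x y := by
  constructor
  · rintro ⟨r, hr⟩
    exact ⟨e.symm r, e.injective (by simpa using hr)⟩
  · rintro ⟨r, rfl⟩
    exact ⟨e r, map_mul _ _ _⟩

theorem rightMul_map_iff (e : R ≃+* S) (x y : R) : RightMul (e x) (e y) ↔ RightMul x y := by
  constructor
  · rintro ⟨r, hr⟩
    exact ⟨e.symm r, e.injective (by simpa using hr)⟩
  · rintro ⟨r, rfl⟩
    exact ⟨e r, map_mul _ _ _⟩

theorem Compat.transport {R' S' : Type*} [Ring R'] [Ring S'] {α η : R → R'}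
    (h : Compat α η) (e : R ≃+* S) (e' : R' ≃+* S') :
    Compat (fun x => e' (α (e.symm x))) (fun x => e' (η (e.symm x))) where
  surj_left := e'.surjective.comp (h.surj_left.comp e.symm.surjective)
  bij_right := e'.bijective.comp (h.bij_right.comp e.symm.bijective)
  map_zero := by simp [h.map_zero]
  map_one := by simp [h.map_one]
  isUnit_iff c x := by
    rw [← map_mul, ← _root_.map_one e', ← map_sub, MulEquiv.isUnit_map, ← h.isUnit_iff,
      ← MulEquiv.isUnit_map e]
    simp
  isRankOne_iff x := by
    rw [isRankOne_map_iff, ← h.isRankOne_iff, isRankOne_map_iff]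
  leftMul_iff x y hx hy := by
    rw [← isRankOne_map_iff e.symm] at hx hy
    rw [leftMul_map_iff, ← h.leftMul_iff _ _ hx hy, leftMul_map_iff]
  rightMul_iff x y hx hy := by
    rw [← isRankOne_map_iff e.symm] at hx hy
    rw [rightMul_map_iff, ← h.rightMul_iff _ _ hx hy, rightMul_map_iff]

theorem Compat.map_add_and_map_mul {K U K' U' : Type*} [DivisionRing K] [AddCommGroup U]
    [Module K U] [DivisionRing K'] [AddCommGroup U'] [Module K' U'] [FiniteDimensional K U]
    [FiniteDimensional K' U'] {α η : R → S} (h : Compat α η)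
    (e : R ≃+* Module.End K U) (e' : S ≃+* Module.End K' U') (hdim : 1 < finrank K U) :
    (∀ x y, α (x + y) = α x + α y) ∧ ∀ x y, α (x * y) = α x * α y := by
  obtain ⟨h1, h2⟩ := (h.transport e e').map_add_and_map_mul_end hdim
  refine ⟨fun x y => e'.injective ?_, fun x y => e'.injective ?_⟩
  · simpa using h1 (e x) (e y)
  · simpa using h2 (e x) (e y)

end Transport

/-- The opposite of an endomorphism ring is an endomorphism ring over the opposite field. -/
noncomputable def endOpRingEquiv (K U : Type*) [DivisionRing K] [AddCommGroup U]
    [Module K U] [FiniteDimensional K U] :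
    (Module.End K U)ᵐᵒᵖ ≃+* Module.End Kᵐᵒᵖ (Fin (finrank K U) → Kᵐᵒᵖ) :=
  let b := (finBasis K U).equivFun
  let e (S : Type _) [DivisionRing S] :
      Module.End S (Fin (finrank K U) → S) ≃+* Matrix _ _ Sᵐᵒᵖ :=
    (endVecRingEquivMatrixEnd (Fin (finrank K U)) S S).trans
      (RingEquiv.moduleEndSelf S).symm.mapMatrix
  (b.conjRingEquiv.trans (e K)).op.trans (RingEquiv.mopMatrix.symm.trans (e Kᵐᵒᵖ).symm)

theorem isUnit_one_sub_mul_swap {R : Type*} [Ring R] {a b : R} (h : IsUnit (1 - a * b)) :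
    IsUnit (1 - b * a) := by
  obtain ⟨u, hu⟩ := h
  have h1 : (1 - a * b) * ↑u⁻¹ = 1 := by rw [← hu]; simp
  have h2 : ↑u⁻¹ * (1 - a * b) = 1 := by rw [← hu]; simp
  refine ⟨⟨1 - b * a, 1 + b * ↑u⁻¹ * a, ?_, ?_⟩, rfl⟩
  · have : (1 - b * a) * (1 + b * ↑u⁻¹ * a) =
        1 - b * a + b * ((1 - a * b) * ↑u⁻¹) * a := by noncomm_ring
    rw [this, h1]; noncomm_ring
  · have : (1 + b * ↑u⁻¹ * a) * (1 - b * a) =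
        1 - b * a + b * (↑u⁻¹ * (1 - a * b)) * a := by noncomm_ring
    rw [this, h2]; noncomm_ring

theorem isUnit_one_sub_mul_comm {R : Type*} [Ring R] (a b : R) :
    IsUnit (1 - a * b) ↔ IsUnit (1 - b * a) :=
  ⟨isUnit_one_sub_mul_swap, isUnit_one_sub_mul_swap⟩

section Op

variable {R : Type*} [Ring R]

theorem isRankOne_op_iff (x : R) : IsRankOne (op x) ↔ IsRankOne x := by
  constructor
  · rintro ⟨h0, h⟩
    refine ⟨fun hx => h0 (by rw [hx, op_zero]), fun a b hab => ?_⟩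
    obtain ⟨s, t, hst⟩ := h (op b) (op a) (by
      rw [← op_mul, ← op_mul, ← mul_assoc]
      exact fun hx => hab (op_injective hx))
    refine ⟨unop t, unop s, ?_⟩
    have := congrArg unop hst
    simpa [mul_assoc] using this
  · rintro ⟨h0, h⟩
    refine ⟨fun hx => h0 (op_injective hx), fun a b hab => ?_⟩
    obtain ⟨s, t, hst⟩ := h (unop b) (unop a) (fun hx => hab (by
      apply unop_injective
      simpa [mul_assoc] using hx))
    refine ⟨op t, op s, unop_injective ?_⟩
    simpa [mul_assoc] using hst

theorem leftMul_op_iff (x y : R) : LeftMul (op x) (op y) ↔ RightMul x y :=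
  ⟨fun ⟨r, hr⟩ => ⟨unop r, by simpa using congrArg unop hr⟩,
    fun ⟨r, hr⟩ => ⟨op r, by rw [hr, op_mul]⟩⟩

theorem rightMul_op_iff (x y : R) : RightMul (op x) (op y) ↔ LeftMul x y :=
  ⟨fun ⟨r, hr⟩ => ⟨unop r, by simpa using congrArg unop hr⟩,
    fun ⟨r, hr⟩ => ⟨op r, by rw [hr, op_mul]⟩⟩

end Op

section Translation

variable {K U : Type*} [DivisionRing K] [AddCommGroup U] [Module K U]

/-- The linear map `u ↦ (u a, u b)`. -/
def rowMap (x : EndOp K U × EndOp K U) : U →ₗ[K] U × U := x.1.unop.prod x.2.unop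

@[simp] theorem rowMap_apply (x : EndOp K U × EndOp K U) (u : U) :
    rowMap x u = (x.1.unop u, x.2.unop u) := rfl

theorem rowMap_smul (r : EndOp K U) (x : EndOp K U × EndOp K U) :
    rowMap (r • x) = rowMap x ∘ₗ r.unop := rfl

/-- The subspace of `U × U` associated with a submodule of `R²`, `R = End U`. -/
def toSubspace (p : Submodule (EndOp K U) (EndOp K U × EndOp K U)) : Submodule K (U × U) :=
  ⨆ x ∈ p, LinearMap.range (rowMap x)

theorem toSubspace_span (x : EndOp K U × EndOp K U) :
    toSubspace (Submodule.span (EndOp K U) {x}) = LinearMap.range (rowMap x) := by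
  apply le_antisymm
  · refine iSup₂_le fun y hy => ?_
    obtain ⟨r, rfl⟩ := Submodule.mem_span_singleton.1 hy
    rw [rowMap_smul]
    exact LinearMap.range_comp_le_range _ _
  · exact le_iSup₂_of_le x (Submodule.mem_span_singleton_self x) le_rfl

theorem mem_span_of_range_le {x y : EndOp K U × EndOp K U}
    (h : LinearMap.range (rowMap y) ≤ LinearMap.range (rowMap x)) :
    y ∈ Submodule.span (EndOp K U) {x} := by
  obtain ⟨r, hr⟩ := Module.projective_lifting_property (rowMap x).rangeRestrict
    ((rowMap y).codRestrict _ fun u => h (LinearMap.mem_range_self _ u))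
    (LinearMap.surjective_rangeRestrict _)
  rw [Submodule.mem_span_singleton]
  refine ⟨op r, ?_⟩
  have key : ∀ u, rowMap x (r u) = rowMap y u := fun u =>
    congrArg Subtype.val (LinearMap.congr_fun hr u)
  refine Prod.ext (unop_injective (LinearMap.ext fun u => ?_))
    (unop_injective (LinearMap.ext fun u => ?_))
  · exact congrArg Prod.fst (key u)
  · exact congrArg Prod.snd (key u)

theorem span_eq_span_iff_range (x y : EndOp K U × EndOp K U) :
    Submodule.span (EndOp K U) {x} = Submodule.span (EndOp K U) {y} ↔
      LinearMap.range (rowMap x) = LinearMap.range (rowMap y) := by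
  constructor
  · intro h
    rw [← toSubspace_span, h, toSubspace_span]
  · intro h
    apply le_antisymm <;> rw [Submodule.span_singleton_le_iff_mem]
    · exact mem_span_of_range_le h.le
    · exact mem_span_of_range_le h.ge

/-- The endomorphism of `U × U` associated with a `2 × 2` matrix. -/
def matrixMap (g : Matrix (Fin 2) (Fin 2) (EndOp K U)) : Module.End K (U × U) :=
  (rowMap (g 0 0, g 0 1)).coprod (rowMap (g 1 0, g 1 1))

theorem matrixMap_mul (g h : Matrix (Fin 2) (Fin 2) (EndOp K U)) :
    matrixMap (g * h) = matrixMap h * matrixMap g := by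
  ext u <;> simp [matrixMap, Matrix.mul_apply]

theorem matrixMap_one : matrixMap (1 : Matrix (Fin 2) (Fin 2) (EndOp K U)) = 1 := by
  ext u <;> simp [matrixMap]

theorem matrixMap_surjective :
    Function.Surjective (matrixMap (K := K) (U := U)) := by
  intro N
  refine ⟨!![op (LinearMap.fst K U U ∘ₗ N ∘ₗ LinearMap.inl K U U),
    op (LinearMap.snd K U U ∘ₗ N ∘ₗ LinearMap.inl K U U);
    op (LinearMap.fst K U U ∘ₗ N ∘ₗ LinearMap.inr K U U),
    op (LinearMap.snd K U U ∘ₗ N ∘ₗ LinearMap.inr K U U)], ?_⟩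
  ext u <;> simp [matrixMap]

theorem matrixMap_injective :
    Function.Injective (matrixMap (K := K) (U := U)) := by
  intro g h hgh
  have key : ∀ (i j : Fin 2) (u : U), (g i j).unop u = (h i j).unop u := by
    intro i j u
    have h0 := LinearMap.congr_fun hgh (u, 0)
    have h1 := LinearMap.congr_fun hgh (0, u)
    simp only [matrixMap, LinearMap.coprod_apply, rowMap_apply, map_zero,
      add_zero, zero_add, Prod.mk.injEq] at h0 h1
    fin_cases i <;> fin_cases j
    exacts [h0.1, h0.2, h1.1, h1.2]
  ext i j
  exact unop_injective (LinearMap.ext (key i j))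

theorem isUnit_matrixMap_iff (g : Matrix (Fin 2) (Fin 2) (EndOp K U)) :
    IsUnit (matrixMap g) ↔ IsUnit g := by
  constructor
  · rintro ⟨u, hu⟩
    obtain ⟨h, hh⟩ := matrixMap_surjective (↑u⁻¹ : Module.End K (U × U))
    refine ⟨⟨g, h, matrixMap_injective ?_, matrixMap_injective ?_⟩, rfl⟩
    · rw [matrixMap_mul, hh, ← hu, matrixMap_one, Units.inv_mul]
    · rw [matrixMap_mul, hh, ← hu, matrixMap_one, Units.mul_inv]
  · rintro ⟨u, rfl⟩
    refine ⟨⟨matrixMap u.val, matrixMap u.inv, ?_, ?_⟩, rfl⟩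
    · rw [← matrixMap_mul, u.inv_val, matrixMap_one]
    · rw [← matrixMap_mul, u.val_inv, matrixMap_one]

variable [FiniteDimensional K U]

theorem finrank_range_rowMap_le (x : EndOp K U × EndOp K U) :
    finrank K (LinearMap.range (rowMap x)) ≤ finrank K U :=
  LinearMap.finrank_range_le _

theorem isUnit_iff_isCompl (a b c d : EndOp K U) :
    IsUnit !![a, b; c, d] ↔
      IsCompl (LinearMap.range (rowMap (a, b))) (LinearMap.range (rowMap (c, d))) := by
  rw [← isUnit_matrixMap_iff, LinearMap.isUnit_iff_range_eq_top]
  have : LinearMap.range (matrixMap !![a, b; c, d]) =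
      LinearMap.range (rowMap (a, b)) ⊔ LinearMap.range (rowMap (c, d)) := by
    simp [matrixMap, LinearMap.range_coprod]
  rw [this]
  refine ⟨fun h => ⟨?_, codisjoint_iff.2 h⟩, fun h => h.sup_eq_top⟩
  have h1 := Submodule.finrank_sup_add_finrank_inf_eq
    (LinearMap.range (rowMap (a, b))) (LinearMap.range (rowMap (c, d)))
  have h2 := finrank_range_rowMap_le (a, b)
  have h3 := finrank_range_rowMap_le (c, d)
  rw [h, finrank_top, finrank_prod] at h1
  rw [disjoint_iff, ← Submodule.finrank_eq_zero (R := K)]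
  omega

theorem finrank_range_of_isCompl {x y : EndOp K U × EndOp K U}
    (h : IsCompl (LinearMap.range (rowMap x)) (LinearMap.range (rowMap y))) :
    finrank K (LinearMap.range (rowMap x)) = finrank K U := by
  have h1 := Submodule.finrank_add_eq_of_isCompl h
  have h2 := finrank_range_rowMap_le x
  have h3 := finrank_range_rowMap_le y
  rw [finrank_prod] at h1
  omega

theorem distant_span_iff (a b c d : EndOp K U) :
    Distant (Submodule.span (EndOp K U) {(a, b)}) (Submodule.span (EndOp K U) {(c, d)}) ↔
      IsUnit !![a, b; c, d] := by
  constructor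
  · rintro ⟨g, h1, h2⟩
    rw [span_eq_span_iff_range] at h1 h2
    rw [isUnit_iff_isCompl, h1, h2, ← isUnit_iff_isCompl]
    have : !![g.val 0 0, g.val 0 1; g.val 1 0, g.val 1 1] = g.val :=
      (Matrix.eta_fin_two _).symm
    rw [this]
    exact g.isUnit
  · rintro ⟨g, hg⟩
    exact ⟨g, by simp [hg], by simp [hg]⟩

theorem exists_rowMap_range (X : Gr K (U × U) (finrank K U)) :
    ∃ x : EndOp K U × EndOp K U, LinearMap.range (rowMap x) = X.1 := by
  let e := LinearEquiv.ofFinrankEq U X.1 X.2.symm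
  refine ⟨(op (LinearMap.fst K U U ∘ₗ X.1.subtype ∘ₗ e.toLinearMap),
    op (LinearMap.snd K U U ∘ₗ X.1.subtype ∘ₗ e.toLinearMap)), ?_⟩
  have : rowMap (op (LinearMap.fst K U U ∘ₗ X.1.subtype ∘ₗ e.toLinearMap),
      op (LinearMap.snd K U U ∘ₗ X.1.subtype ∘ₗ e.toLinearMap)) =
      X.1.subtype ∘ₗ e.toLinearMap := by
    ext u <;> simp
  rw [this, LinearMap.range_comp_of_range_eq_top _ (LinearEquiv.range e),
    Submodule.range_subtype]

theorem finrank_prod_self : finrank K (U × U) = 2 * finrank K U := by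
  rw [finrank_prod, two_mul]

theorem isPoint_span_iff (a b : EndOp K U) :
    IsPoint (EndOp K U) (Submodule.span (EndOp K U) {(a, b)}) ↔
      finrank K (LinearMap.range (rowMap (a, b))) = finrank K U := by
  constructor
  · rintro ⟨g, hg⟩
    rw [span_eq_span_iff_range] at hg
    have h1 : IsUnit !![g.val 0 0, g.val 0 1; g.val 1 0, g.val 1 1] := by
      rw [← Matrix.eta_fin_two]
      exact g.isUnit
    rw [hg]
    exact finrank_range_of_isCompl ((isUnit_iff_isCompl _ _ _ _).1 h1)
  · intro h
    obtain ⟨Y, -, hY⟩ := Gr.exists_opp finrank_prod_self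
      (⟨_, h⟩ : Gr K (U × U) (finrank K U)) disjoint_bot_left
    obtain ⟨⟨c, d⟩, hcd⟩ := exists_rowMap_range Y
    have h1 : IsCompl Y.1 (LinearMap.range (rowMap (a, b))) := hY
    rw [← hcd] at h1
    obtain ⟨g, hg⟩ := (isUnit_iff_isCompl _ _ _ _).2 h1.symm
    exact ⟨g, by simp [hg]⟩

theorem IsPoint.exists_span {R : Type*} [Ring R] {p : Submodule R (R × R)}
    (hp : IsPoint R p) : ∃ a b, p = Submodule.span R {(a, b)} := by
  obtain ⟨g, hg⟩ := hp
  exact ⟨_, _, hg⟩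

variable (K U) in
/-- The points of the projective line over `End U` are the subspaces of half dimension
of `U × U`. -/
noncomputable def pointEquiv : PL (EndOp K U) ≃ Gr K (U × U) (finrank K U) :=
  Equiv.ofBijective (fun p => ⟨toSubspace p.1, by
    obtain ⟨p, hp⟩ := p
    obtain ⟨a, b, rfl⟩ := IsPoint.exists_span hp
    rw [toSubspace_span]
    exact (isPoint_span_iff a b).1 hp⟩) (by
    constructor
    · rintro ⟨p, hp⟩ ⟨q, hq⟩ h
      obtain ⟨a, b, rfl⟩ := IsPoint.exists_span hp
      obtain ⟨c, d, rfl⟩ := IsPoint.exists_span hq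
      have h1 := congrArg Subtype.val h
      simp only [toSubspace_span] at h1
      exact Subtype.ext ((span_eq_span_iff_range _ _).2 h1)
    · intro X
      obtain ⟨⟨a, b⟩, hab⟩ := exists_rowMap_range X
      refine ⟨⟨Submodule.span (EndOp K U) {(a, b)}, ?_⟩, Subtype.ext ?_⟩
      · rw [isPoint_span_iff, hab, X.2]
      · exact (toSubspace_span _).trans hab)

theorem pointEquiv_span {a b : EndOp K U}
    (h : IsPoint (EndOp K U) (Submodule.span (EndOp K U) {(a, b)})) :
    (pointEquiv K U ⟨_, h⟩).1 = LinearMap.range (rowMap (a, b)) := toSubspace_span _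

/-- The distant relation on the type of points. -/
def PointDistant {R : Type*} [Ring R] (p q : PL R) : Prop := Distant p.1 q.1

theorem pointDistant_iff_opp (p q : PL (EndOp K U)) :
    PointDistant p q ↔ Opp (pointEquiv K U p) (pointEquiv K U q) := by
  obtain ⟨p, hp⟩ := p
  obtain ⟨q, hq⟩ := q
  obtain ⟨a, b, rfl⟩ := IsPoint.exists_span hp
  obtain ⟨c, d, rfl⟩ := IsPoint.exists_span hq
  rw [Opp, pointEquiv_span, pointEquiv_span, ← isUnit_iff_isCompl, ← distant_span_iff]
  rfl

theorem isGeometry_pointDistant (h : 1 ≤ finrank K U) :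
    IsGeometry (PointDistant (R := EndOp K U)) :=
  (Gr.isGeometry finrank_prod_self h).of_equiv (pointEquiv K U) pointDistant_iff_opp

theorem eq_of_pointDistant_iff {A p q : PL (EndOp K U)}
    (h : ∀ z, PointDistant z A → (PointDistant z p ↔ PointDistant z q)) : p = q := by
  apply (pointEquiv K U).injective
  refine Gr.eq_of_opp_iff finrank_prod_self (A := pointEquiv K U A) fun Z hZ => ?_
  obtain ⟨z, rfl⟩ := (pointEquiv K U).surjective Z
  rw [← pointDistant_iff_opp] at hZ
  rw [← pointDistant_iff_opp, ← pointDistant_iff_opp]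
  exact h z hZ

end Translation

section Grid

variable {X : Type*} {ρ κ ρ' κ' : X → X → Prop}

theorem Grid.row_or_col (hρ : Equivalence ρ) (hρ' : Equivalence ρ') (hκ' : Equivalence κ')
    (hor : ∀ x y, (ρ x y ∨ κ x y) ↔ (ρ' x y ∨ κ' x y)) (x : X) :
    (∀ y, ρ x y → ρ' x y) ∨ ∀ y, ρ x y → κ' x y := by
  by_contra hcon
  push Not at hcon
  obtain ⟨⟨y, hy, hy'⟩, w, hw, hw'⟩ := hcon
  have h1 := ((hor x y).1 (Or.inl hy)).resolve_left hy'
  have h2 := ((hor x w).1 (Or.inl hw)).resolve_right hw'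
  rcases (hor y w).1 (Or.inl (hρ.trans (hρ.symm hy) hw)) with h | h
  · exact hy' (hρ'.trans h2 (hρ'.symm h))
  · exact hw' (hκ'.trans h1 h)

theorem Grid.not_both (hρ : Equivalence ρ) (hκ : Equivalence κ) (hρ' : Equivalence ρ')
    (hor : ∀ x y, (ρ x y ∨ κ x y) ↔ (ρ' x y ∨ κ' x y))
    (hrow : ∀ x, ∃ y, ρ x y ∧ ¬ κ x y) (hcol : ∀ x, ∃ y, κ x y ∧ ¬ ρ x y) (x : X)
    (h1 : ∀ y, ρ x y → ρ' x y) (h2 : ∀ y, κ x y → ρ' x y) : False := by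
  obtain ⟨y, hy, hy'⟩ := hrow x
  obtain ⟨w, hw, hw'⟩ := hcol x
  rcases (hor y w).2 (Or.inl (hρ'.trans (hρ'.symm (h1 y hy)) (h2 w hw))) with h | h
  · exact hw' (hρ.trans hy h)
  · exact hy' (hκ.trans hw (hκ.symm h))

/-- Rows and columns of a grid are determined up to a swap by the relation of sharing a row
or a column. -/
theorem Grid.eq_or_swap (hρ : Equivalence ρ) (hκ : Equivalence κ) (hρ' : Equivalence ρ')
    (hκ' : Equivalence κ') (hor : ∀ x y, (ρ x y ∨ κ x y) ↔ (ρ' x y ∨ κ' x y))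
    (hand : ∀ x y, (ρ x y ∧ κ x y) ↔ (ρ' x y ∧ κ' x y))
    (hgrid : ∀ x y, ∃ z, ρ x z ∧ κ z y)
    (hrow : ∀ x, ∃ y, ρ x y ∧ ¬ κ x y) (hcol : ∀ x, ∃ y, κ x y ∧ ¬ ρ x y) :
    (∀ x y, (ρ x y ↔ ρ' x y) ∧ (κ x y ↔ κ' x y)) ∨
      ∀ x y, (ρ x y ↔ κ' x y) ∧ (κ x y ↔ ρ' x y) := by
  have hor' : ∀ x y, (κ x y ∨ ρ x y) ↔ (ρ' x y ∨ κ' x y) := fun x y => by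
    rw [or_comm, hor]
  have hors : ∀ x y, (ρ x y ∨ κ x y) ↔ (κ' x y ∨ ρ' x y) := fun x y => by
    rw [hor, or_comm]
  have excl : ∀ x, (∀ y, ρ x y → ρ' x y) → ¬ ∀ y, ρ x y → κ' x y := by
    intro x h1 h2
    obtain ⟨y, hy, hy'⟩ := hrow x
    exact hy' ((hand x y).2 ⟨h1 y hy, h2 y hy⟩).2
  have dich : ∀ x, ((∀ y, ρ x y → ρ' x y) ∧ ∀ y, κ x y → κ' x y) ∨
      ((∀ y, ρ x y → κ' x y) ∧ ∀ y, κ x y → ρ' x y) := by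
    intro x
    rcases Grid.row_or_col hρ hρ' hκ' hor x with h1 | h1 <;>
      rcases Grid.row_or_col hκ hρ' hκ' hor' x with h2 | h2
    · exact (Grid.not_both hρ hκ hρ' hor hrow hcol x h1 h2).elim
    · exact Or.inl ⟨h1, h2⟩
    · exact Or.inr ⟨h1, h2⟩
    · exact (Grid.not_both hρ hκ hκ' hors hrow hcol x h1 h2).elim
  have propagate : ∀ {r r' : X → X → Prop}, Equivalence r → Equivalence r' → ∀ {x y},
      (∀ z, r x z → r' x z) → r x y → ∀ z, r y z → r' y z :=
    fun hr hr' _ _ h hxy z hz => hr'.trans (hr'.symm (h _ hxy)) (h _ (hr.trans hxy hz))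
  by_cases hall : ∃ x, (∀ y, ρ x y → ρ' x y) ∧ ∀ y, κ x y → κ' x y
  · left
    obtain ⟨x, hx1, hx2⟩ := hall
    have key : ∀ y, (∀ z, ρ y z → ρ' y z) ∧ ∀ z, κ y z → κ' y z := by
      intro y
      obtain ⟨z, hxz, hzy⟩ := hgrid x y
      have hz := propagate hρ hρ' hx1 hxz
      rcases dich z with hz2 | hz2
      · have hy := propagate hκ hκ' hz2.2 hzy
        rcases dich y with hy2 | hy2
        · exact hy2
        · exfalso
          obtain ⟨w, hw, hw'⟩ := hcol y
          exact hw' ((hand y w).2 ⟨hy2.2 w hw, hy w hw⟩).1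
      · exact (excl z hz hz2.1).elim
    intro x y
    refine ⟨⟨(key x).1 y, fun h => ?_⟩, ⟨(key x).2 y, fun h => ?_⟩⟩
    · rcases (hor x y).2 (Or.inl h) with h' | h'
      · exact h'
      · exact ((hand x y).2 ⟨h, (key x).2 y h'⟩).1
    · rcases (hor x y).2 (Or.inr h) with h' | h'
      · exact ((hand x y).2 ⟨(key x).1 y h', h⟩).2
      · exact h'
  · right
    push Not at hall
    have key : ∀ y, (∀ z, ρ y z → κ' y z) ∧ ∀ z, κ y z → ρ' y z := fun y =>
      (dich y).resolve_left fun h => by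
        obtain ⟨z, hz, hz'⟩ := hall y h.1
        exact hz' (h.2 z hz)
    intro x y
    refine ⟨⟨(key x).1 y, fun h => ?_⟩, ⟨(key x).2 y, fun h => ?_⟩⟩
    · rcases (hor x y).2 (Or.inr h) with h' | h'
      · exact h'
      · exact ((hand x y).2 ⟨(key x).2 y h', h⟩).1
    · rcases (hor x y).2 (Or.inl h) with h' | h'
      · exact ((hand x y).2 ⟨h, (key x).1 y h'⟩).2
      · exact h'

end Grid

section RankOneGrid

variable {K U : Type*} [DivisionRing K] [AddCommGroup U] [Module K U]

theorem LeftMul.trans {R : Type*} [Ring R] {x y z : R} (h : LeftMul x y) (h' : LeftMul y z) :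
    LeftMul x z := by
  obtain ⟨r, rfl⟩ := h
  obtain ⟨s, rfl⟩ := h'
  exact ⟨s * r, (mul_assoc _ _ _).symm⟩

theorem RightMul.trans {R : Type*} [Ring R] {x y z : R} (h : RightMul x y)
    (h' : RightMul y z) : RightMul x z := by
  obtain ⟨r, rfl⟩ := h
  obtain ⟨s, rfl⟩ := h'
  exact ⟨r * s, mul_assoc _ _ _⟩

theorem leftMul_symm_end {x y : Module.End K U} (hx : IsRankOne x) (hy : IsRankOne y)
    (h : LeftMul x y) : LeftMul y x := by
  obtain ⟨f, u, hf, hu, rfl⟩ := (isRankOne_iff x).1 hx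
  obtain ⟨v, rfl⟩ := (leftMul_smulRight_iff hu y).1 h
  have hv : v ≠ 0 := by
    rintro rfl
    exact hy.1 (by simp)
  exact (leftMul_smulRight_iff hv _).2 ⟨u, rfl⟩

theorem rightMul_symm_end {x y : Module.End K U} (hx : IsRankOne x) (hy : IsRankOne y)
    (h : RightMul x y) : RightMul y x := by
  obtain ⟨f, u, hf, hu, rfl⟩ := (isRankOne_iff x).1 hx
  obtain ⟨g, rfl⟩ := (rightMul_smulRight_iff hf y).1 h
  have hg : g ≠ 0 := by
    rintro rfl
    exact hy.1 (by simp)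
  exact (rightMul_smulRight_iff hg _).2 ⟨f, rfl⟩

theorem exists_leftMul_rightMul_end {x y : Module.End K U} (hx : IsRankOne x)
    (hy : IsRankOne y) : ∃ z, IsRankOne z ∧ LeftMul x z ∧ RightMul z y := by
  obtain ⟨f, u, hf, hu, rfl⟩ := (isRankOne_iff x).1 hx
  obtain ⟨g, v, hg, hv, rfl⟩ := (isRankOne_iff y).1 hy
  exact ⟨f.smulRight v, isRankOne_smulRight hf hv, (leftMul_smulRight_iff hu _).2 ⟨v, rfl⟩,
    (rightMul_smulRight_iff hf _).2 ⟨g, rfl⟩⟩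

theorem exists_leftMul_not_rightMul_end (hdim : 1 < finrank K U) {x : Module.End K U}
    (hx : IsRankOne x) : ∃ y, IsRankOne y ∧ LeftMul x y ∧ ¬ RightMul x y := by
  obtain ⟨f, u, hf, hu, rfl⟩ := (isRankOne_iff x).1 hx
  obtain ⟨w, hw⟩ := exists_notMem_span_singleton hdim u
  have hw0 : w ≠ 0 := by
    rintro rfl
    exact hw (zero_mem _)
  exact ⟨f.smulRight w, isRankOne_smulRight hf hw0, (leftMul_smulRight_iff hu _).2 ⟨w, rfl⟩,
    fun h => hw ((rightMul_smulRight_smulRight_iff hf hf).1 h)⟩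

theorem exists_rightMul_not_leftMul_end [FiniteDimensional K U] (hdim : 1 < finrank K U)
    {x : Module.End K U} (hx : IsRankOne x) :
    ∃ y, IsRankOne y ∧ RightMul x y ∧ ¬ LeftMul x y := by
  obtain ⟨f, u, hf, hu, rfl⟩ := (isRankOne_iff x).1 hx
  obtain ⟨v, hv, hv0⟩ : ∃ v ∈ LinearMap.ker f, v ≠ 0 := by
    refine (Submodule.ne_bot_iff _).1 fun h => ?_
    have := LinearMap.finrank_le_finrank_of_injective (LinearMap.ker_eq_bot.1 h)
    rw [finrank_self] at this
    omega
  obtain ⟨g, hg⟩ := exists_functional_eq_one (K := K) hv0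
  have hg0 : g ≠ 0 := by
    rintro rfl
    simp at hg
  refine ⟨g.smulRight u, isRankOne_smulRight hg0 hu, (rightMul_smulRight_iff hf _).2 ⟨g, rfl⟩,
    fun h => ?_⟩
  obtain ⟨w, hw⟩ := (leftMul_smulRight_iff hu _).1 h
  have := LinearMap.congr_fun hw v
  rw [LinearMap.mem_ker] at hv
  simp [hg, hv, hu] at this

theorem leftMul_or_rightMul_iff_end {x y : Module.End K U} (hx : IsRankOne x)
    (hy : IsRankOne y) : (LeftMul x y ∨ RightMul x y) ↔ (x = y ∨ IsRankOne (x - y)) := by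
  obtain ⟨f, u, hf, hu, rfl⟩ := (isRankOne_iff x).1 hx
  constructor
  · rintro (h | h)
    · obtain ⟨v, rfl⟩ := (leftMul_smulRight_iff hu y).1 h
      by_cases huv : u = v
      · exact Or.inl (by rw [huv])
      · right
        have : f.smulRight u - f.smulRight v = f.smulRight (u - v) := by
          ext z; simp [smul_sub]
        rw [this]
        exact isRankOne_smulRight hf (sub_ne_zero.2 huv)
    · obtain ⟨g, rfl⟩ := (rightMul_smulRight_iff hf y).1 h
      by_cases hfg : f = g
      · exact Or.inl (by rw [hfg])
      · right
        have : f.smulRight u - g.smulRight u = (f - g).smulRight u := by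
          ext z; simp [sub_smul]
        rw [this]
        exact isRankOne_smulRight (sub_ne_zero.2 hfg) hu
  · rintro (rfl | h)
    · exact Or.inl ⟨1, (one_mul _).symm⟩
    obtain ⟨g, v, hg, hv, rfl⟩ := (isRankOne_iff y).1 hy
    obtain ⟨l, w, hl, hw, hlw⟩ := (isRankOne_iff _).1 h
    have key : ∀ z, f z • u - g z • v = l z • w := fun z => LinearMap.congr_fun hlw z
    by_contra hcon
    push Not at hcon
    obtain ⟨h1, h2⟩ := hcon
    rw [rightMul_smulRight_smulRight_iff hf hg] at h2
    have hind : ∀ a b : K, a • u = b • v → a = 0 ∧ b = 0 := by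
      intro a b hab
      have hb : b = 0 := by
        by_contra hb
        exact h2 (Submodule.mem_span_singleton.2 ⟨b⁻¹ * a, by
          rw [mul_smul, hab, smul_smul, inv_mul_cancel₀ hb, one_smul]⟩)
      refine ⟨?_, hb⟩
      rw [hb, zero_smul, smul_eq_zero] at hab
      exact hab.resolve_right hu
    have hker : LinearMap.ker l ≤ LinearMap.ker f ∧ LinearMap.ker l ≤ LinearMap.ker g := by
      refine ⟨fun z hz => ?_, fun z hz => ?_⟩ <;>
      · have := key z
        rw [LinearMap.mem_ker] at hz ⊢
        rw [hz, zero_smul, sub_eq_zero] at this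
        first | exact (hind _ _ this).1 | exact (hind _ _ this).2
    obtain ⟨z₀, hz₀⟩ := exists_apply_eq_one hl
    have hf' : ∀ z, f z = l z * f z₀ := fun z => by
      have : z - l z • z₀ ∈ LinearMap.ker f := hker.1 (by simp [hz₀])
      simpa [sub_eq_zero] using this
    have hg' : ∀ z, g z = l z * g z₀ := fun z => by
      have : z - l z • z₀ ∈ LinearMap.ker g := hker.2 (by simp [hz₀])
      simpa [sub_eq_zero] using this
    have hfz : f z₀ ≠ 0 := fun h0 => hf (LinearMap.ext fun z => by simp [hf' z, h0])
    refine h1 ((leftMul_smulRight_iff hu _).2 ⟨((f z₀)⁻¹ * g z₀) • v, ?_⟩)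
    ext z
    simp only [LinearMap.smulRight_apply, smul_smul]
    rw [hg' z, hf' z, mul_assoc, mul_inv_cancel_left₀ hfz]

end RankOneGrid

section RankOneMaps

theorem equivalence_leftMul {K U : Type*} [DivisionRing K] [AddCommGroup U] [Module K U] :
    Equivalence fun x y : {x : Module.End K U // IsRankOne x} => LeftMul x.1 y.1 :=
  ⟨fun _ => ⟨1, (one_mul _).symm⟩, fun h => leftMul_symm_end (Subtype.property _)
    (Subtype.property _) h, fun h h' => h.trans h'⟩

theorem equivalence_rightMul {K U : Type*} [DivisionRing K] [AddCommGroup U] [Module K U] :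
    Equivalence fun x y : {x : Module.End K U // IsRankOne x} => RightMul x.1 y.1 :=
  ⟨fun _ => ⟨1, (mul_one _).symm⟩, fun h => rightMul_symm_end (Subtype.property _)
    (Subtype.property _) h, fun h h' => h.trans h'⟩

variable {K U K' U' : Type*} [DivisionRing K] [AddCommGroup U] [Module K U]
  [DivisionRing K'] [AddCommGroup U'] [Module K' U'] [FiniteDimensional K U]

theorem leftMul_rightMul_or_swap_end (hdim : 1 < finrank K U)
    {η : Module.End K U → Module.End K' U'} (hinj : Function.Injective η)
    (hrk : ∀ x, IsRankOne x ↔ IsRankOne (η x))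
    (hsub : ∀ x y, IsRankOne (x - y) ↔ IsRankOne (η x - η y))
    (hand : ∀ x y, IsRankOne x → IsRankOne y →
      ((LeftMul x y ∧ RightMul x y) ↔ (LeftMul (η x) (η y) ∧ RightMul (η x) (η y)))) :
    (∀ x y, IsRankOne x → IsRankOne y →
      ((LeftMul x y ↔ LeftMul (η x) (η y)) ∧ (RightMul x y ↔ RightMul (η x) (η y)))) ∨
    ∀ x y, IsRankOne x → IsRankOne y →
      ((LeftMul x y ↔ RightMul (η x) (η y)) ∧ (RightMul x y ↔ LeftMul (η x) (η y))) := by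
  let f : {x : Module.End K U // IsRankOne x} → {x : Module.End K' U' // IsRankOne x} :=
    fun x => ⟨η x.1, (hrk _).1 x.2⟩
  have := Grid.eq_or_swap (equivalence_leftMul (K := K) (U := U))
    (equivalence_rightMul (K := K) (U := U))
    ((equivalence_leftMul (K := K') (U := U')).comap f)
    ((equivalence_rightMul (K := K') (U := U')).comap f)
    (fun x y => by
      rw [leftMul_or_rightMul_iff_end x.2 y.2, hsub, ← hinj.eq_iff]
      exact (leftMul_or_rightMul_iff_end ((hrk _).1 x.2) ((hrk _).1 y.2)).symm)
    (fun x y => hand x.1 y.1 x.2 y.2)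
    (fun x y => by
      obtain ⟨z, hz, h⟩ := exists_leftMul_rightMul_end x.2 y.2
      exact ⟨⟨z, hz⟩, h⟩)
    (fun x => by
      obtain ⟨z, hz, h⟩ := exists_leftMul_not_rightMul_end hdim x.2
      exact ⟨⟨z, hz⟩, h⟩)
    (fun x => by
      obtain ⟨z, hz, h⟩ := exists_rightMul_not_leftMul_end hdim x.2
      exact ⟨⟨z, hz⟩, h⟩)
  exact this.imp (fun h x y hx hy => h ⟨x, hx⟩ ⟨y, hy⟩) fun h x y hx hy => h ⟨x, hx⟩ ⟨y, hy⟩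

theorem leftMul_rightMul_or_swap {R S : Type*} [Ring R] [Ring S]
    (e : R ≃+* Module.End K U) (e' : S ≃+* Module.End K' U') (hdim : 1 < finrank K U)
    {η : R → S} (hinj : Function.Injective η)
    (hrk : ∀ x, IsRankOne x ↔ IsRankOne (η x))
    (hsub : ∀ x y, IsRankOne (x - y) ↔ IsRankOne (η x - η y))
    (hand : ∀ x y, IsRankOne x → IsRankOne y →
      ((LeftMul x y ∧ RightMul x y) ↔ (LeftMul (η x) (η y) ∧ RightMul (η x) (η y)))) :
    (∀ x y, IsRankOne x → IsRankOne y →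
      ((LeftMul x y ↔ LeftMul (η x) (η y)) ∧ (RightMul x y ↔ RightMul (η x) (η y)))) ∨
    ∀ x y, IsRankOne x → IsRankOne y →
      ((LeftMul x y ↔ RightMul (η x) (η y)) ∧ (RightMul x y ↔ LeftMul (η x) (η y))) := by
  have := leftMul_rightMul_or_swap_end hdim (η := fun x => e' (η (e.symm x)))
    (e'.injective.comp (hinj.comp e.symm.injective))
    (fun x => by rw [isRankOne_map_iff, ← hrk, isRankOne_map_iff])
    (fun x y => by rw [← map_sub, isRankOne_map_iff, ← hsub, ← map_sub, isRankOne_map_iff])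
    (fun x y hx hy => by
      rw [← isRankOne_map_iff e.symm] at hx hy
      have := hand _ _ hx hy
      simpa only [leftMul_map_iff, rightMul_map_iff] using this)
  refine this.imp (fun h x y hx hy => ?_) fun h x y hx hy => ?_ <;>
  · rw [← isRankOne_map_iff e] at hx hy
    have := h _ _ hx hy
    simp only [RingEquiv.symm_apply_apply] at this
    simpa only [leftMul_map_iff, rightMul_map_iff] using this

end RankOneMaps

section Action

variable {R : Type*} [Ring R]

/-- Multiplication of row vectors with a matrix, as a linear map. -/
def rowMulLin (g : Matrix (Fin 2) (Fin 2) R) : R × R →ₗ[R] R × R where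
  toFun x := rowMul x.1 x.2 g
  map_add' x y := by
    simp only [rowMul, Prod.fst_add, Prod.snd_add, Prod.mk_add_mk, add_mul]
    congr 1 <;> abel
  map_smul' r x := by
    simp [rowMul, mul_assoc, mul_add]

theorem rowMulLin_apply (g : Matrix (Fin 2) (Fin 2) R) (x y : R) :
    rowMulLin g (x, y) = rowMul x y g := rfl

theorem rowMulLin_row (g h : Matrix (Fin 2) (Fin 2) R) (i : Fin 2) :
    rowMulLin g (h i 0, h i 1) = ((h * g) i 0, (h * g) i 1) := by
  simp [rowMulLin_apply, rowMul, Matrix.mul_apply]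

theorem rowMulLin_mul (g h : Matrix (Fin 2) (Fin 2) R) (x : R × R) :
    rowMulLin (g * h) x = rowMulLin h (rowMulLin g x) := by
  simp only [rowMulLin, rowMul, LinearMap.coe_mk, AddHom.coe_mk, Matrix.mul_apply,
    Fin.sum_univ_two, Prod.mk.injEq]
  constructor <;> noncomm_ring

theorem rowMulLin_one : rowMulLin (1 : Matrix (Fin 2) (Fin 2) R) = LinearMap.id := by
  ext <;> simp [rowMulLin, rowMul]

theorem map_rowMulLin_span (g : Matrix (Fin 2) (Fin 2) R) (x y : R) :
    (Submodule.span R {(x, y)}).map (rowMulLin g) = Submodule.span R {rowMul x y g} := by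
  rw [Submodule.map_span, Set.image_singleton, rowMulLin_apply]

theorem isPoint_map_rowMulLin (g : (Matrix (Fin 2) (Fin 2) R)ˣ) {p : Submodule R (R × R)}
    (hp : IsPoint R p) : IsPoint R (p.map (rowMulLin g.val)) := by
  obtain ⟨h, rfl⟩ := hp
  refine ⟨h * g, ?_⟩
  rw [Submodule.map_span, Set.image_singleton, rowMulLin_row, Units.val_mul]

theorem distant_map_rowMulLin (g : (Matrix (Fin 2) (Fin 2) R)ˣ) {p q : Submodule R (R × R)}
    (h : Distant p q) : Distant (p.map (rowMulLin g.val)) (q.map (rowMulLin g.val)) := by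
  obtain ⟨h, rfl, rfl⟩ := h
  refine ⟨h * g, ?_, ?_⟩ <;>
    rw [Submodule.map_span, Set.image_singleton, rowMulLin_row, Units.val_mul]

theorem map_rowMulLin_map (g h : Matrix (Fin 2) (Fin 2) R) (p : Submodule R (R × R)) :
    (p.map (rowMulLin g)).map (rowMulLin h) = p.map (rowMulLin (g * h)) := by
  rw [← Submodule.map_comp]
  congr 1
  exact LinearMap.ext fun x => (rowMulLin_mul g h x).symm

/-- The projectivity of the projective line induced by an invertible matrix. -/
def projectivity (g : (Matrix (Fin 2) (Fin 2) R)ˣ) : PL R ≃ PL R where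
  toFun p := ⟨p.1.map (rowMulLin g.val), isPoint_map_rowMulLin g p.2⟩
  invFun p := ⟨p.1.map (rowMulLin g⁻¹.val), isPoint_map_rowMulLin g⁻¹ p.2⟩
  left_inv p := Subtype.ext (by
    simp only [map_rowMulLin_map, Units.mul_inv, rowMulLin_one, Submodule.map_id])
  right_inv p := Subtype.ext (by
    simp only [map_rowMulLin_map, Units.inv_mul, rowMulLin_one, Submodule.map_id])

theorem pointDistant_projectivity (g : (Matrix (Fin 2) (Fin 2) R)ˣ) (p q : PL R) :
    PointDistant p q ↔ PointDistant (projectivity g p) (projectivity g q) := by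
  refine ⟨distant_map_rowMulLin g, fun h => ?_⟩
  have := distant_map_rowMulLin g⁻¹ h
  simp only [projectivity, Equiv.coe_fn_mk, map_rowMulLin_map, Units.mul_inv, rowMulLin_one,
    Submodule.map_id] at this
  exact this

/-- The points `R(1, c)`. -/
def affinePoint (c : R) : PL R :=
  ⟨Submodule.span R {(1, c)}, ⟨⟨!![1, c; 0, 1], !![1, -c; 0, 1],
    by simp [Matrix.one_fin_two], by simp [Matrix.one_fin_two]⟩, by simp⟩⟩

/-- The points `R(y, 1)`. -/
def coaffinePoint (y : R) : PL R :=
  ⟨Submodule.span R {(y, 1)}, ⟨⟨!![y, 1; 1, 0], !![0, 1; 1, -y],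
    by simp [Matrix.one_fin_two], by simp [Matrix.one_fin_two]⟩, by simp⟩⟩

/-- The matrix with rows `(b, 1)` and `(ab - 1, a)`. -/
def jordanMatrix (a b : R) : (Matrix (Fin 2) (Fin 2) R)ˣ :=
  ⟨!![b, 1; a * b - 1, a], !![a, -1; 1 - b * a, b], by
    rw [Matrix.mul_fin_two, Matrix.one_fin_two]
    congr <;> noncomm_ring, by
    rw [Matrix.mul_fin_two, Matrix.one_fin_two]
    congr <;> noncomm_ring⟩

/-- The matrix that exchanges the two coordinates. -/
def swapMatrix : (Matrix (Fin 2) (Fin 2) R)ˣ :=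
  ⟨!![0, 1; 1, 0], !![0, 1; 1, 0], by simp [Matrix.one_fin_two], by simp [Matrix.one_fin_two]⟩

/-- The points `R(ab - 1, a)`. -/
def jordanPoint (a b : R) : PL R :=
  ⟨Submodule.span R {(a * b - 1, a)}, ⟨swapMatrix * jordanMatrix a b, by
    simp [swapMatrix, jordanMatrix, Matrix.mul_apply]⟩⟩

end Action

section Matrices

variable {R : Type*} [Ring R]

theorem isUnit_matrix_left_one_iff (c x y : R) :
    IsUnit !![1, c; x, y] ↔ IsUnit (y - x * c) := by
  have hu : IsUnit !![1, 0; x, 1] := ⟨⟨!![1, 0; x, 1], !![1, 0; -x, 1],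
    by simp [Matrix.one_fin_two], by simp [Matrix.one_fin_two]⟩, rfl⟩
  have hmul : !![1, c; x, y] = !![1, 0; x, 1] * !![1, c; 0, y - x * c] := by simp
  rw [hmul, hu.mul_left_iff]
  generalize y - x * c = d
  constructor
  · rintro ⟨⟨g, h, hgh, hhg⟩, rfl : g = _⟩
    rw [Matrix.eta_fin_two h, Matrix.mul_fin_two, Matrix.one_fin_two] at hgh hhg
    have h1 := congrFun₂ hhg 1 0
    have h2 := congrFun₂ hhg 1 1
    have h3 := congrFun₂ hgh 1 1
    simp at h1 h2 h3
    rw [h1, zero_mul, zero_add] at h2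
    exact ⟨⟨d, h 1 1, h3, h2⟩, rfl⟩
  · rintro ⟨u, rfl⟩
    exact ⟨⟨!![1, c; 0, u], !![1, -(c * ↑u⁻¹); 0, ↑u⁻¹], by simp [Matrix.one_fin_two],
      by simp [Matrix.one_fin_two]⟩, rfl⟩

theorem isUnit_matrix_zero_one_iff (d c : R) : IsUnit !![d, c; 0, 1] ↔ IsUnit d := by
  constructor
  · rintro ⟨⟨g, h, hgh, hhg⟩, rfl : g = _⟩
    rw [Matrix.eta_fin_two h, Matrix.mul_fin_two, Matrix.one_fin_two] at hgh hhg
    have h1 := congrFun₂ hgh 1 0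
    have h2 := congrFun₂ hgh 0 0
    have h3 := congrFun₂ hhg 0 0
    simp at h1 h2 h3
    rw [h1, mul_zero, add_zero] at h2
    exact ⟨⟨d, h 0 0, h2, h3⟩, rfl⟩
  · rintro ⟨u, rfl⟩
    exact ⟨⟨!![↑u, c; 0, 1], !![↑u⁻¹, -(↑u⁻¹ * c); 0, 1], by simp [Matrix.one_fin_two],
      by simp [Matrix.one_fin_two]⟩, rfl⟩

theorem isUnit_matrix_one_zero_iff (a b : R) : IsUnit !![a, b; 1, 0] ↔ IsUnit b := by
  have hs := (swapMatrix (R := R)).isUnit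
  have hmul : !![a, b; 1, 0] = !![b, a; 0, 1] * (swapMatrix (R := R)).val := by
    simp [swapMatrix]
  rw [hmul, hs.mul_right_iff, isUnit_matrix_zero_one_iff]

theorem isUnit_matrix_jordan_iff (a b c : R) :
    IsUnit !![1, c; a * b - 1, a] ↔ IsUnit (a + c - c * b * a) := by
  have hmul : !![1, c; a * b - 1, a] * (jordanMatrix a b)⁻¹.val =
      !![a + c - c * b * a, c * b - 1; 0, 1] := by
    change _ * !![a, -1; 1 - b * a, b] = _
    rw [Matrix.mul_fin_two]
    congr <;> noncomm_ring
  rw [← isUnit_matrix_zero_one_iff _ (c * b - 1), ← hmul, (jordanMatrix a b)⁻¹.isUnit.mul_right_iff]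

theorem affinePoint_injective : Function.Injective (affinePoint (R := R)) := by
  intro c d h
  have h1 : ((1 : R), d) ∈ Submodule.span R {((1 : R), c)} := by
    rw [show Submodule.span R _ = Submodule.span R _ from congrArg Subtype.val h]
    exact Submodule.mem_span_singleton_self _
  obtain ⟨r, hr⟩ := Submodule.mem_span_singleton.1 h1
  simp only [Prod.smul_mk, smul_eq_mul, mul_one, Prod.mk.injEq] at hr
  simpa [hr.1] using hr.2

theorem coaffinePoint_injective : Function.Injective (coaffinePoint (R := R)) := by
  intro c d h
  have h1 : (d, (1 : R)) ∈ Submodule.span R {(c, (1 : R))} := by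
    rw [show Submodule.span R _ = Submodule.span R _ from congrArg Subtype.val h]
    exact Submodule.mem_span_singleton_self _
  obtain ⟨r, hr⟩ := Submodule.mem_span_singleton.1 h1
  simp only [Prod.smul_mk, smul_eq_mul, mul_one, Prod.mk.injEq] at hr
  simpa [hr.2] using hr.1

theorem span_units_smul (u : Rˣ) (x : R × R) :
    Submodule.span R {(u : R) • x} = Submodule.span R {x} :=
  Submodule.span_singleton_smul_eq u.isUnit x

end Matrices

section Charts

variable {K U : Type*} [DivisionRing K] [AddCommGroup U] [Module K U]

theorem isRankOne_iff_finrank_range (x : Module.End K U) :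
    IsRankOne x ↔ finrank K (LinearMap.range x) = 1 := by
  rw [isRankOne_iff]
  constructor
  · rintro ⟨h, u, hh, hu, rfl⟩
    have : LinearMap.range (h.smulRight u) = Submodule.span K {u} := by
      obtain ⟨w, hw⟩ := exists_apply_eq_one hh
      apply le_antisymm
      · rintro _ ⟨z, rfl⟩
        exact Submodule.mem_span_singleton.2 ⟨h z, rfl⟩
      · rw [Submodule.span_singleton_le_iff_mem]
        exact ⟨w, by simp [hw]⟩
    rw [this, finrank_span_singleton hu]
  · intro h
    obtain ⟨⟨u, hu⟩, hu0, hspan⟩ := finrank_eq_one_iff'.1 h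
    have hu0 : u ≠ 0 := fun h0 => hu0 (Subtype.ext h0)
    obtain ⟨g, hg⟩ := exists_functional_eq_one (K := K) hu0
    have hx : x = (g ∘ₗ x).smulRight u := by
      ext z
      obtain ⟨c, hc⟩ := hspan ⟨x z, z, rfl⟩
      have hc : c • u = x z := congrArg Subtype.val hc
      simp [← hc, hg]
    refine ⟨g ∘ₗ x, u, fun h0 => ?_, hu0, hx⟩
    rw [h0] at hx
    obtain ⟨z, rfl⟩ := hu
    exact hu0 (by rw [hx]; simp)

theorem mem_range_rowMap_one (y : EndOp K U) (z : U × U) :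
    z ∈ LinearMap.range (rowMap (y, 1)) ↔ z.1 = y.unop z.2 := by
  constructor
  · rintro ⟨u, rfl⟩
    rfl
  · intro h
    exact ⟨z.2, Prod.ext h.symm rfl⟩

variable [FiniteDimensional K U]

theorem pointDistant_symm {p q : PL (EndOp K U)} (h : PointDistant p q) : PointDistant q p := by
  rw [pointDistant_iff_opp] at h ⊢
  exact IsCompl.symm h

theorem pointDistant_affinePoint_coaffinePoint (c y : EndOp K U) :
    PointDistant (affinePoint c) (coaffinePoint y) ↔ IsUnit (1 - y * c) :=
  (distant_span_iff _ _ _ _).trans (isUnit_matrix_left_one_iff _ _ _)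

theorem pointDistant_affinePoint_affinePoint (c d : EndOp K U) :
    PointDistant (affinePoint c) (affinePoint d) ↔ IsUnit (d - c) :=
  (distant_span_iff _ _ _ _).trans (by rw [isUnit_matrix_left_one_iff, one_mul])

theorem pointDistant_affinePoint_jordanPoint (c a b : EndOp K U) :
    PointDistant (affinePoint c) (jordanPoint a b) ↔ IsUnit (a + c - a * b * c) :=
  (distant_span_iff _ _ _ _).trans (by
    rw [isUnit_matrix_left_one_iff]
    congr! 1
    noncomm_ring)

theorem pointDistant_affinePoint_jordanPoint' (c a b : EndOp K U) :
    PointDistant (affinePoint c) (jordanPoint a b) ↔ IsUnit (a + c - c * b * a) :=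
  (distant_span_iff _ _ _ _).trans (isUnit_matrix_jordan_iff _ _ _)

theorem pointDistant_coaffinePoint_zero_iff (p : PL (EndOp K U)) :
    PointDistant p (coaffinePoint 0) ↔ ∃ c, p = affinePoint c := by
  constructor
  · obtain ⟨p, hp⟩ := p
    obtain ⟨a, b, rfl⟩ := IsPoint.exists_span hp
    intro h
    obtain ⟨u, rfl⟩ := (isUnit_matrix_zero_one_iff _ _).1 ((distant_span_iff _ _ _ _).1 h)
    refine ⟨↑u⁻¹ * b, Subtype.ext ?_⟩
    refine (span_units_smul u⁻¹ _).symm.trans ?_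
    simp [affinePoint]
  · rintro ⟨c, rfl⟩
    simp [pointDistant_affinePoint_coaffinePoint]

theorem pointDistant_affinePoint_zero_iff (p : PL (EndOp K U)) :
    PointDistant p (affinePoint 0) ↔ ∃ y, p = coaffinePoint y := by
  constructor
  · obtain ⟨p, hp⟩ := p
    obtain ⟨a, b, rfl⟩ := IsPoint.exists_span hp
    intro h
    obtain ⟨u, rfl⟩ := (isUnit_matrix_one_zero_iff _ _).1 ((distant_span_iff _ _ _ _).1 h)
    refine ⟨↑u⁻¹ * a, Subtype.ext ?_⟩
    refine (span_units_smul u⁻¹ _).symm.trans ?_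
    simp [coaffinePoint]
  · rintro ⟨y, rfl⟩
    apply pointDistant_symm
    simp [pointDistant_affinePoint_coaffinePoint]

theorem pointEquiv_coaffinePoint (y : EndOp K U) :
    (pointEquiv K U (coaffinePoint y)).1 = LinearMap.range (rowMap (y, 1)) :=
  pointEquiv_span _

theorem adj_coaffinePoint_iff (x y : EndOp K U) :
    Adj PointDistant (coaffinePoint x) (coaffinePoint y) ↔ IsRankOne (x - y) := by
  rw [adj_equiv (pointEquiv K U) pointDistant_iff_opp, Gr.adj_iff finrank_prod_self,
    pointEquiv_coaffinePoint, pointEquiv_coaffinePoint, ← op_unop (x - y), isRankOne_op_iff,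
    isRankOne_iff_finrank_range]
  have hmap : (LinearMap.ker (x - y).unop).map (rowMap (x, 1)) =
      LinearMap.range (rowMap (x, 1)) ⊓ LinearMap.range (rowMap (y, 1)) := by
    ext z
    rw [Submodule.mem_inf, mem_range_rowMap_one, mem_range_rowMap_one]
    constructor
    · rintro ⟨u, hu, rfl⟩
      have : x.unop u - y.unop u = 0 := hu
      exact ⟨rfl, sub_eq_zero.1 this⟩
    · rintro ⟨h1, h2⟩
      refine ⟨z.2, ?_, Prod.ext h1.symm rfl⟩
      change x.unop z.2 - y.unop z.2 = 0
      rw [← h1, ← h2, sub_self]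
  have hinj : Function.Injective (rowMap (x, (1 : EndOp K U))) := fun u v h =>
    congrArg Prod.snd h
  rw [← hmap, ← (Submodule.equivMapOfInjective _ hinj _).finrank_eq]
  have := LinearMap.finrank_range_add_finrank_ker (x - y).unop
  omega

theorem adj_coaffinePoint_zero_iff (x : EndOp K U) :
    Adj PointDistant (coaffinePoint x) (coaffinePoint 0) ↔ IsRankOne x := by
  rw [adj_coaffinePoint_iff, sub_zero]

theorem near_coaffinePoint_iff {x y : EndOp K U} (hx : IsRankOne x) (hy : IsRankOne y) :
    Near PointDistant (coaffinePoint 0) (coaffinePoint x) (coaffinePoint y) ↔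
      LeftMul x y ∧ RightMul x y := by
  obtain ⟨x, rfl⟩ := op_surjective x
  obtain ⟨y, rfl⟩ := op_surjective y
  have hx' := hx
  rw [isRankOne_op_iff] at hx hy
  rw [leftMul_op_iff, rightMul_op_iff]
  constructor
  · intro h
    by_cases hxy : x = y
    · subst hxy
      exact ⟨⟨1, (mul_one _).symm⟩, ⟨1, (one_mul _).symm⟩⟩
    rw [near_equiv (pointEquiv K U) pointDistant_iff_opp] at h
    obtain ⟨-, h1, h2⟩ := mem_pencil_of_near finrank_prod_self
      (fun h0 => hy.1 (op_injective
        (coaffinePoint_injective ((pointEquiv K U).injective h0))))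
      (fun h0 => hxy (op_injective
        (coaffinePoint_injective ((pointEquiv K U).injective h0))).symm) h
    rw [pointEquiv_coaffinePoint, pointEquiv_coaffinePoint, pointEquiv_coaffinePoint] at h1 h2
    obtain ⟨f, u, hf, hu, rfl⟩ := (isRankOne_iff x).1 hx
    obtain ⟨g, v, hg, hv, rfl⟩ := (isRankOne_iff y).1 hy
    constructor
    · rw [rightMul_smulRight_smulRight_iff hf hg]
      obtain ⟨w, hw⟩ := exists_apply_eq_one hg
      have : ((v, w) : U × U) ∈ LinearMap.range (rowMap (op (g.smulRight v), 1)) := by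
        rw [mem_range_rowMap_one]
        simp [hw]
      obtain ⟨a, ha, b, hb, hab⟩ := Submodule.mem_sup.1 (h2 this)
      rw [mem_range_rowMap_one] at ha hb
      have h3 := congrArg Prod.fst hab
      simp only [Prod.fst_add, ha, hb] at h3
      exact Submodule.mem_span_singleton.2 ⟨f b.2, by simpa using h3⟩
    · rw [leftMul_smulRight_iff hu]
      obtain ⟨z₀, hz₀⟩ := exists_apply_eq_one hf
      refine ⟨g z₀ • v, LinearMap.ext fun z => ?_⟩
      have hz : ((0, z - f z • z₀) : U × U) ∈ LinearMap.range (rowMap (op (g.smulRight v), 1)) :=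
        h1 ⟨by rw [SetLike.mem_coe, mem_range_rowMap_one]; simp, by
          rw [SetLike.mem_coe, mem_range_rowMap_one]; simp [hz₀]⟩
      rw [mem_range_rowMap_one] at hz
      simp only [unop_op, LinearMap.smulRight_apply, map_sub, map_smul] at hz
      rw [eq_comm, sub_eq_zero] at hz
      simp [hz]
  · rintro ⟨⟨r, rfl⟩, s, hs⟩
    rw [near_equiv (pointEquiv K U) pointDistant_iff_opp]
    refine near_of_mem_pencil finrank_prod_self ?_ ?_ ?_
    · rw [← Gr.adj_iff finrank_prod_self,
        ← adj_equiv (pointEquiv K U) pointDistant_iff_opp]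
      exact ((adj_coaffinePoint_zero_iff _).2 hx').symm
    · rw [pointEquiv_coaffinePoint, pointEquiv_coaffinePoint, pointEquiv_coaffinePoint]
      rintro z ⟨h1, h2⟩
      rw [SetLike.mem_coe, mem_range_rowMap_one] at h1 h2
      rw [mem_range_rowMap_one, h1, hs]
      simp only [unop_zero, LinearMap.zero_apply, unop_op, Module.End.mul_apply] at h1 h2 ⊢
      rw [← h2, h1, map_zero]
    · rw [pointEquiv_coaffinePoint, pointEquiv_coaffinePoint, pointEquiv_coaffinePoint]
      rintro _ ⟨u, rfl⟩
      refine Submodule.mem_sup.2 ⟨(0, u - r u), ?_, (x (r u), r u), ?_, ?_⟩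
      · simp
      · simp
      · simp

end Charts

section Normalized

/-- A bijective additive map that preserves or reverses products. -/
structure IsIsoOrAnti {R S : Type*} [Ring R] [Ring S] (α : R → S) : Prop where
  bijective : Function.Bijective α
  map_add : ∀ x y, α (x + y) = α x + α y
  map_one : α 1 = 1
  map_mul : (∀ x y, α (x * y) = α x * α y) ∨ ∀ x y, α (x * y) = α y * α x

theorem IsIsoOrAnti.isUnit_iff {R S : Type*} [Ring R] [Ring S] {α : R → S}
    (h : IsIsoOrAnti α) (x : R) : IsUnit x ↔ IsUnit (α x) := by
  rcases h.map_mul with hm | hm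
  · let e : R ≃* S := { Equiv.ofBijective α h.bijective with map_mul' := hm }
    exact (MulEquiv.isUnit_map e).symm
  · let e : R ≃* Sᵐᵒᵖ := { (Equiv.ofBijective α h.bijective).trans opEquiv with
      map_mul' := fun x y => by
        change op (α (x * y)) = op (α x) * op (α y)
        rw [hm, op_mul] }
    rw [← MulEquiv.isUnit_map e]
    exact isUnit_op

theorem IsIsoOrAnti.map_sub {R S : Type*} [Ring R] [Ring S] {α : R → S}
    (h : IsIsoOrAnti α) (x y : R) : α (x - y) = α x - α y := by
  rw [eq_sub_iff_add_eq, ← h.map_add, sub_add_cancel]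

variable {K U K' U' : Type*} [DivisionRing K] [AddCommGroup U] [Module K U]
  [FiniteDimensional K U] [DivisionRing K'] [AddCommGroup U'] [Module K' U']
  [FiniteDimensional K' U']

theorem exists_isIsoOrAnti_of_fixed (hdim : 1 < finrank K U)
    (f : PL (EndOp K U) ≃ PL (EndOp K' U'))
    (hf : ∀ p q, PointDistant p q ↔ PointDistant (f p) (f q))
    (h0 : f (affinePoint 0) = affinePoint 0) (h1 : f (affinePoint 1) = affinePoint 1)
    (h2 : f (coaffinePoint 0) = coaffinePoint 0) :
    ∃ α : EndOp K U → EndOp K' U', IsIsoOrAnti α ∧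
      ∀ a b, f (jordanPoint a b) = jordanPoint (α a) (α b) := by
  have hα : ∀ c, ∃ d, f (affinePoint c) = affinePoint d := fun c => by
    rw [← pointDistant_coaffinePoint_zero_iff, ← h2, ← hf, pointDistant_coaffinePoint_zero_iff]
    exact ⟨c, rfl⟩
  have hη : ∀ c, ∃ d, f (coaffinePoint c) = coaffinePoint d := fun c => by
    rw [← pointDistant_affinePoint_zero_iff, ← h0, ← hf, pointDistant_affinePoint_zero_iff]
    exact ⟨c, rfl⟩
  choose α hα using hα
  choose η hη using hη
  have hα0 : ∀ c d, f (affinePoint c) = affinePoint d → α c = d := fun c d h =>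
    affinePoint_injective ((hα c).symm.trans h)
  have hη0 : ∀ c d, f (coaffinePoint c) = coaffinePoint d → η c = d := fun c d h =>
    coaffinePoint_injective ((hη c).symm.trans h)
  have hαs : Function.Surjective α := fun d => by
    obtain ⟨c, hc⟩ := (pointDistant_coaffinePoint_zero_iff (f.symm (affinePoint d))).1 (by
      rw [hf, h2, Equiv.apply_symm_apply, pointDistant_coaffinePoint_zero_iff]
      exact ⟨d, rfl⟩)
    exact ⟨c, hα0 _ _ (by rw [← hc, Equiv.apply_symm_apply])⟩
  have hηs : Function.Surjective η := fun d => by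
    obtain ⟨c, hc⟩ := (pointDistant_affinePoint_zero_iff (f.symm (coaffinePoint d))).1 (by
      rw [hf, h0, Equiv.apply_symm_apply, pointDistant_affinePoint_zero_iff]
      exact ⟨d, rfl⟩)
    exact ⟨c, hη0 _ _ (by rw [← hc, Equiv.apply_symm_apply])⟩
  have hαi : Function.Injective α := fun c d h => by
    apply affinePoint_injective
    apply f.injective
    rw [hα, hα, h]
  have hηi : Function.Injective η := fun c d h => by
    apply coaffinePoint_injective
    apply f.injective
    rw [hη, hη, h]
  have hα1 : α 1 = 1 := hα0 _ _ h1
  have hηz : η 0 = 0 := hη0 _ _ h2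
  have hunit : ∀ c x, IsUnit (1 - c * x) ↔ IsUnit (1 - α c * η x) := fun c x => by
    rw [isUnit_one_sub_mul_comm, ← pointDistant_affinePoint_coaffinePoint, hf, hα, hη,
      pointDistant_affinePoint_coaffinePoint, isUnit_one_sub_mul_comm]
  have hsub : ∀ x y, IsRankOne (x - y) ↔ IsRankOne (η x - η y) := fun x y => by
    rw [← adj_coaffinePoint_iff, adj_equiv f hf, hη, hη, adj_coaffinePoint_iff]
  have hrk : ∀ x, IsRankOne x ↔ IsRankOne (η x) := fun x => by
    rw [← sub_zero x, hsub, hηz, sub_zero, sub_zero]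
  have hand : ∀ x y, IsRankOne x → IsRankOne y →
      ((LeftMul x y ∧ RightMul x y) ↔ (LeftMul (η x) (η y) ∧ RightMul (η x) (η y))) :=
    fun x y hx hy => by
      rw [← near_coaffinePoint_iff hx hy, near_equiv f hf, h2, hη, hη,
        near_coaffinePoint_iff ((hrk x).1 hx) ((hrk y).1 hy)]
  have hdim' : 1 < finrank Kᵐᵒᵖ (Fin (finrank K U) → Kᵐᵒᵖ) := by
    rwa [Module.finrank_fin_fun]
  have hiso : IsIsoOrAnti α := by
    rcases leftMul_rightMul_or_swap (endOpRingEquiv K U) (endOpRingEquiv K' U') hdim' hηi hrk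
      hsub hand with h | h
    · have hc : Compat α η := ⟨hαs, ⟨hηi, hηs⟩, hηz, hα1, hunit, hrk,
        fun x y hx hy => (h x y hx hy).1, fun x y hx hy => (h x y hx hy).2⟩
      obtain ⟨ha, hm⟩ :=
        hc.map_add_and_map_mul (endOpRingEquiv K U) (endOpRingEquiv K' U') hdim'
      exact ⟨⟨hαi, hαs⟩, ha, hα1, Or.inl hm⟩
    · have hc : Compat (fun x => op (α x)) (fun x => op (η x)) :=
        ⟨op_surjective.comp hαs, op_bijective.comp ⟨hηi, hηs⟩, by rw [hηz, op_zero],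
          by rw [hα1, op_one], fun c x => by
            rw [hunit, isUnit_one_sub_mul_comm, ← isUnit_op, op_sub, op_one, op_mul],
          fun x => by rw [isRankOne_op_iff, hrk],
          fun x y hx hy => by rw [leftMul_op_iff, (h x y hx hy).1],
          fun x y hx hy => by rw [rightMul_op_iff, (h x y hx hy).2]⟩
      obtain ⟨ha, hm⟩ := hc.map_add_and_map_mul (endOpRingEquiv K U)
        (RingEquiv.opOp (Module.End K' U')).symm hdim'
      exact ⟨⟨hαi, hαs⟩, fun x y => op_injective (ha x y), hα1,
        Or.inr fun x y => op_injective (hm x y)⟩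
  refine ⟨α, hiso, fun a b => ?_⟩
  refine eq_of_pointDistant_iff (A := coaffinePoint 0) fun z hz => ?_
  obtain ⟨c, rfl⟩ := (pointDistant_coaffinePoint_zero_iff z).1 hz
  obtain ⟨c, rfl⟩ := hαs c
  rw [← hα, ← hf, hα, pointDistant_affinePoint_jordanPoint, hiso.isUnit_iff]
  rcases hiso.map_mul with hm | hm
  · rw [pointDistant_affinePoint_jordanPoint, hiso.map_sub, hiso.map_add, hm, hm]
  · rw [pointDistant_affinePoint_jordanPoint', hiso.map_sub, hiso.map_add, hm, hm, mul_assoc]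

end Normalized

section General

variable {K U K' U' : Type*} [DivisionRing K] [AddCommGroup U] [Module K U]
  [DivisionRing K'] [AddCommGroup U'] [Module K' U'] [FiniteDimensional K' U']
  [FiniteDimensional K U]

/-- Every distant triple of points is projectively equivalent to the standard one. -/
theorem exists_projectivity_of_distant {p q r : PL (EndOp K U)} (hpq : PointDistant p q)
    (hpr : PointDistant r p) (hqr : PointDistant r q) :
    ∃ g, projectivity g (affinePoint 0) = p ∧ projectivity g (coaffinePoint 0) = q ∧
      projectivity g (affinePoint 1) = r := by
  obtain ⟨g, hg1, hg2⟩ := hpq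
  have hp : projectivity g (affinePoint 0) = p := Subtype.ext (by
    rw [hg1]
    exact (map_rowMulLin_span _ _ _).trans (by simp [rowMul]))
  have hq : projectivity g (coaffinePoint 0) = q := Subtype.ext (by
    rw [hg2]
    exact (map_rowMulLin_span _ _ _).trans (by simp [rowMul]))
  obtain ⟨r, rfl⟩ := (projectivity g).surjective r
  rw [← hp, ← pointDistant_projectivity] at hpr
  rw [← hq, ← pointDistant_projectivity, pointDistant_coaffinePoint_zero_iff] at hqr
  obtain ⟨c, rfl⟩ := hqr
  rw [pointDistant_affinePoint_affinePoint, zero_sub, IsUnit.neg_iff] at hpr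
  obtain ⟨u, rfl⟩ := hpr
  let d : (Matrix (Fin 2) (Fin 2) (EndOp K U))ˣ := ⟨!![1, 0; 0, u], !![1, 0; 0, ↑u⁻¹],
    by simp [Matrix.one_fin_two], by simp [Matrix.one_fin_two]⟩
  have hd : ∀ x y : EndOp K U, (Submodule.span (EndOp K U) {(x, y)}).map (rowMulLin d.val) =
      Submodule.span (EndOp K U) {(x, y * u)} := fun x y => by
    rw [map_rowMulLin_span]
    simp [rowMul, d]
  have hmul : ∀ s, projectivity (d * g) s = projectivity g (projectivity d s) := fun s =>
    Subtype.ext (map_rowMulLin_map _ _ _).symm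
  refine ⟨d * g, ?_, ?_, ?_⟩
  · rw [hmul, ← hp]
    congr 1
    exact Subtype.ext ((hd _ _).trans (by simp [affinePoint]))
  · rw [hmul, ← hq]
    congr 1
    refine Subtype.ext ((hd _ _).trans (Eq.trans ?_ (span_units_smul u _)))
    simp
  · rw [hmul]
    congr 1
    exact Subtype.ext ((hd _ _).trans (by simp [affinePoint]))

theorem exists_isIsoOrAnti (hdim : 1 < finrank K U)
    (f : PL (EndOp K U) ≃ PL (EndOp K' U'))
    (hf : ∀ p q, PointDistant p q ↔ PointDistant (f p) (f q)) :
    ∃ (g : (Matrix (Fin 2) (Fin 2) (EndOp K' U'))ˣ) (α : EndOp K U → EndOp K' U'),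
      IsIsoOrAnti α ∧ ∀ a b,
        (f (jordanPoint a b)).1 =
          Submodule.span (EndOp K' U') {rowMul (α a * α b - 1) (α a) g.val} := by
  obtain ⟨g, h0, h2, h1⟩ := exists_projectivity_of_distant
    (p := f (affinePoint 0)) (q := f (coaffinePoint 0)) (r := f (affinePoint 1))
    (by rw [← hf, pointDistant_affinePoint_coaffinePoint]; simp)
    (by rw [← hf, pointDistant_affinePoint_affinePoint]; simp)
    (by rw [← hf, pointDistant_affinePoint_coaffinePoint]; simp)
  obtain ⟨α, hα, hαf⟩ := exists_isIsoOrAnti_of_fixed hdim (f.trans (projectivity g).symm)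
    (fun p q => by
      rw [hf, pointDistant_projectivity g ((f.trans (projectivity g).symm) p)]
      simp)
    (by simp [← h0]) (by simp [← h1]) (by simp [← h2])
  refine ⟨g, α, hα, fun a b => ?_⟩
  have := hαf a b
  rw [Equiv.trans_apply, Equiv.symm_apply_eq] at this
  rw [this]
  exact map_rowMulLin_span _ _ _

end General

section Components

variable {I : Type*} {R : I → Type*} [∀ i, Ring (R i)]

theorem component_span (x : (Π i, R i) × (Π i, R i)) (j : I) :
    component (Submodule.span (Π i, R i) {x}) j =
      Submodule.span (R j) {(x.1 j, x.2 j)} := by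
  rw [component, Submodule.map_span, Set.image_singleton]
  rfl

theorem span_le_span_of_component_le {x y : (Π i, R i) × (Π i, R i)}
    (h : ∀ j, component (Submodule.span (Π i, R i) {x}) j ≤
      component (Submodule.span (Π i, R i) {y}) j) :
    Submodule.span (Π i, R i) {x} ≤ Submodule.span (Π i, R i) {y} := by
  rw [Submodule.span_singleton_le_iff_mem, Submodule.mem_span_singleton]
  have : ∀ j, ∃ r : R j, r • (y.1 j, y.2 j) = (x.1 j, x.2 j) := fun j => by
    have := h j
    rwa [component_span, component_span, Submodule.span_singleton_le_iff_mem,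
      Submodule.mem_span_singleton] at this
  choose r hr using this
  exact ⟨r, Prod.ext (funext fun j => congrArg Prod.fst (hr j))
    (funext fun j => congrArg Prod.snd (hr j))⟩

theorem span_eq_span_of_component_eq {x y : (Π i, R i) × (Π i, R i)}
    (h : ∀ j, component (Submodule.span (Π i, R i) {x}) j =
      component (Submodule.span (Π i, R i) {y}) j) :
    Submodule.span (Π i, R i) {x} = Submodule.span (Π i, R i) {y} :=
  le_antisymm (span_le_span_of_component_le fun j => (h j).le)
    (span_le_span_of_component_le fun j => (h j).ge)

/-- The component of an invertible matrix over a product of rings. -/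
def componentUnit (g : (Matrix (Fin 2) (Fin 2) (Π i, R i))ˣ) (j : I) :
    (Matrix (Fin 2) (Fin 2) (R j))ˣ :=
  Units.map (RingHom.mapMatrix (Pi.evalRingHom R j)).toMonoidHom g

theorem of_mul_of_eq_one {g h : ∀ i, Matrix (Fin 2) (Fin 2) (R i)} (H : ∀ i, g i * h i = 1) :
    (Matrix.of fun a b i => g i a b : Matrix (Fin 2) (Fin 2) (Π i, R i)) *
      Matrix.of (fun a b i => h i a b) = 1 := by
  refine Matrix.ext fun a b => funext fun i => ?_
  rw [Matrix.mul_apply, Finset.sum_apply]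
  refine (congrFun₂ (H i) a b).trans ?_
  rw [Matrix.one_apply, Matrix.one_apply]
  split_ifs <;> rfl

/-- The invertible matrix over a product of rings with given components. -/
def piUnit (g : ∀ i, (Matrix (Fin 2) (Fin 2) (R i))ˣ) :
    (Matrix (Fin 2) (Fin 2) (Π i, R i))ˣ where
  val := Matrix.of fun a b i => (g i).val a b
  inv := Matrix.of fun a b i => (g i)⁻¹.val a b
  val_inv := of_mul_of_eq_one fun i => (g i).mul_inv
  inv_val := of_mul_of_eq_one fun i => (g i).inv_mul

theorem isPoint_component {p : Submodule (Π i, R i) ((Π i, R i) × (Π i, R i))}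
    (hp : IsPoint (Π i, R i) p) (j : I) : IsPoint (R j) (component p j) := by
  obtain ⟨g, rfl⟩ := hp
  exact ⟨componentUnit g j, component_span _ _⟩

theorem distant_component {p q : Submodule (Π i, R i) ((Π i, R i) × (Π i, R i))}
    (h : Distant p q) (j : I) : Distant (component p j) (component q j) := by
  obtain ⟨g, rfl, rfl⟩ := h
  exact ⟨componentUnit g j, component_span _ _, component_span _ _⟩

theorem eq_of_component_eq {p q : Submodule (Π i, R i) ((Π i, R i) × (Π i, R i))}
    (hp : IsPoint (Π i, R i) p) (hq : IsPoint (Π i, R i) q)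
    (h : ∀ j, component p j = component q j) : p = q := by
  obtain ⟨g, rfl⟩ := hp
  obtain ⟨k, rfl⟩ := hq
  exact span_eq_span_of_component_eq h

theorem distant_iff_component {p q : Submodule (Π i, R i) ((Π i, R i) × (Π i, R i))}
    (hp : IsPoint (Π i, R i) p) (hq : IsPoint (Π i, R i) q) :
    Distant p q ↔ ∀ j, Distant (component p j) (component q j) := by
  refine ⟨fun h => distant_component h, fun h => ?_⟩
  choose g hg1 hg2 using h
  obtain ⟨a, rfl⟩ := hp
  obtain ⟨b, rfl⟩ := hq
  refine ⟨piUnit g, span_eq_span_of_component_eq fun j => ?_,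
    span_eq_span_of_component_eq fun j => ?_⟩
  · rw [hg1, component_span]
    rfl
  · rw [hg2, component_span]
    rfl

theorem exists_point_of_components (x : ∀ i, PL (R i)) :
    ∃ p : PL (Π i, R i), ∀ i, component p.1 i = (x i).1 := by
  choose g hg using fun i => (x i).2
  exact ⟨⟨_, piUnit g, rfl⟩, fun i => by rw [component_span, hg]; rfl⟩

/-- The canonical identification of the projective line over a product of rings with the
product of the projective lines. -/
noncomputable def componentsEquiv (R : I → Type*) [∀ i, Ring (R i)] :
    PL (Π i, R i) ≃ ∀ i, PL (R i) :=
  Equiv.ofBijective (fun p i => ⟨component p.1 i, isPoint_component p.2 i⟩)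
    ⟨fun p q h => Subtype.ext (eq_of_component_eq p.2 q.2 fun j =>
      congrArg Subtype.val (congrFun h j)), fun x => by
      obtain ⟨p, hp⟩ := exists_point_of_components x
      exact ⟨p, funext fun i => Subtype.ext (hp i)⟩⟩

theorem componentsEquiv_apply (p : PL (Π i, R i)) (i : I) :
    (componentsEquiv R p i).1 = component p.1 i := rfl

theorem pointDistant_iff_piRel (p q : PL (Π i, R i)) :
    PointDistant p q ↔
      PiRel (fun _ => PointDistant) (componentsEquiv R p) (componentsEquiv R q) :=
  distant_iff_component p.2 q.2

theorem component_jordanPoint (a b : Π i, R i) (j : I) :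
    componentsEquiv R (jordanPoint a b) j = jordanPoint (a j) (b j) :=
  Subtype.ext (component_span _ _)

end Components

section Maps

variable {I J : Type*} {R : I → Type*} {S : J → Type*}

/-- The map of products that acts as `αc k` on the component `k`. -/
def reindexMap (σ : I ≃ J) (αc : ∀ k, R k → S (σ k)) (x : Π i, R i) : Π j, S j :=
  Equiv.piCongrLeft S σ fun k => αc k (x k)

theorem reindexMap_apply (σ : I ≃ J) (αc : ∀ k, R k → S (σ k)) (x : Π i, R i) (k : I) :
    reindexMap σ αc x (σ k) = αc k (x k) :=
  Equiv.piCongrLeft_apply_apply S σ _ k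

theorem reindexMap_bijective (σ : I ≃ J) {αc : ∀ k, R k → S (σ k)}
    (h : ∀ k, Function.Bijective (αc k)) : Function.Bijective (reindexMap σ αc) :=
  (Equiv.piCongrLeft S σ).bijective.comp
    (Equiv.piCongrRight fun k => Equiv.ofBijective (αc k) (h k)).bijective

theorem forall_eq_of_reindex (σ : I ≃ J) {x y : Π j, S j} (h : ∀ k, x (σ k) = y (σ k)) :
    x = y :=
  funext fun j => by
    obtain ⟨k, rfl⟩ := σ.surjective j
    exact h k

variable [∀ i, Ring (R i)] [∀ j, Ring (S j)]

theorem exists_isDisIso {A B : Type*} [Ring A] [Ring B] (f : PL A ≃ PL B)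
    (hf : ∀ p q, PointDistant p q ↔ PointDistant (f p) (f q)) :
    ∃ F : Submodule A (A × A) → Submodule B (B × B), IsDisIso F ∧ ∀ p, F p.1 = (f p).1 := by
  classical
  let F : Submodule A (A × A) → Submodule B (B × B) :=
    fun p => if h : IsPoint A p then (f ⟨p, h⟩).1 else ⊥
  have hF : ∀ p (h : IsPoint A p), F p = (f ⟨p, h⟩).1 := fun p h => dif_pos h
  refine ⟨F, ⟨⟨fun p hp => ?_, fun p hp q hq hpq => ?_, fun q hq => ?_⟩, fun p q hp hq => ?_⟩,
    fun p => hF p.1 p.2⟩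
  · rw [hF p hp]
    exact (f _).2
  · rw [hF p hp, hF q hq] at hpq
    exact congrArg Subtype.val (f.injective (Subtype.ext hpq))
  · refine ⟨(f.symm ⟨q, hq⟩).1, (f.symm ⟨q, hq⟩).2, ?_⟩
    rw [hF _ (f.symm ⟨q, hq⟩).2]
    simp
  · rw [hF p hp, hF q hq]
    exact hf ⟨p, hp⟩ ⟨q, hq⟩

theorem bijective_of_components (φ : PL (Π i, R i) → PL (Π j, S j)) (σ : I ≃ J)
    (φc : ∀ k, Submodule (R k) (R k × R k) → Submodule (S (σ k)) (S (σ k) × S (σ k)))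
    (hφc : ∀ k, IsDisIso (φc k))
    (h : ∀ (p : PL (Π i, R i)) k, component (φ p).1 (σ k) = φc k (component p.1 k)) :
    Function.Bijective φ ∧ ∀ p q, (Distant p.1 q.1 ↔ Distant (φ p).1 (φ q).1) := by
  refine ⟨⟨fun p q hpq => ?_, fun q => ?_⟩, fun p q => ?_⟩
  · refine Subtype.ext (eq_of_component_eq p.2 q.2 fun k => ?_)
    apply (hφc k).1.injOn (isPoint_component p.2 k) (isPoint_component q.2 k)
    rw [← h, ← h, hpq]
  · choose x hx hxq using fun k => (hφc k).1.surjOn (isPoint_component q.2 (σ k))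
    obtain ⟨p, hp⟩ := exists_point_of_components fun k => (⟨x k, hx k⟩ : PL (R k))
    refine ⟨p, Subtype.ext (eq_of_component_eq (φ p).2 q.2 fun j => ?_)⟩
    obtain ⟨k, rfl⟩ := σ.surjective j
    rw [h, hp, hxq]
  · rw [distant_iff_component p.2 q.2, distant_iff_component (φ p).2 (φ q).2,
      ← σ.forall_congr_right]
    refine forall_congr' fun k => ?_
    rw [h, h]
    exact (hφc k).2 _ _ (isPoint_component p.2 k) (isPoint_component q.2 k)

theorem exists_components [Finite I] (hR : ∀ i, IsGeometry (PointDistant (R := R i)))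
    (hS : ∀ j, IsGeometry (PointDistant (R := S j))) {φ : PL (Π i, R i) → PL (Π j, S j)}
    (hφ : Function.Bijective φ)
    (hφd : ∀ p q, (Distant p.1 q.1 ↔ Distant (φ p).1 (φ q).1)) :
    ∃ (σ : I ≃ J) (f : ∀ i, PL (R i) ≃ PL (S (σ i))),
      (∀ i p q, PointDistant p q ↔ PointDistant (f i p) (f i q)) ∧
      ∀ p i, componentsEquiv S (φ p) (σ i) = f i (componentsEquiv R p i) := by
  let F : (∀ i, PL (R i)) ≃ ∀ j, PL (S j) :=
    (componentsEquiv R).symm.trans ((Equiv.ofBijective φ hφ).trans (componentsEquiv S))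
  obtain ⟨σ, f, hf, hF⟩ := exists_decomposition hR hS F (fun x y => by
    obtain ⟨p, rfl⟩ := (componentsEquiv R).surjective x
    obtain ⟨q, rfl⟩ := (componentsEquiv R).surjective y
    rw [← pointDistant_iff_piRel]
    exact (hφd p q).trans ((pointDistant_iff_piRel (φ p) (φ q)).trans (by simp [F])))
    fun i => affinePoint 0
  exact ⟨σ, f, hf, fun p i => by simpa [F] using hF (componentsEquiv R p) i⟩

theorem exists_reindex_unit (σ : I ≃ J) (g : ∀ k, (Matrix (Fin 2) (Fin 2) (S (σ k)))ˣ) :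
    ∃ γ : (Matrix (Fin 2) (Fin 2) (Π j, S j))ˣ, ∀ a b k, γ.val a b (σ k) = (g k).val a b :=
  ⟨piUnit (Equiv.piCongrLeft (fun j => (Matrix (Fin 2) (Fin 2) (S j))ˣ) σ g), fun a b k => by
    change ((Equiv.piCongrLeft (fun j => (Matrix (Fin 2) (Fin 2) (S j))ˣ) σ g) (σ k)).val a b = _
    rw [Equiv.piCongrLeft_apply_apply]⟩

end Maps

end DistantGeometry

open DistantGeometry

/-- Let `R = Π_{i=1}^m End_{K_i}(U_i)`,
`R' = Π_{j=1}^{m'} End_{K'_j}(U'_j)` (finite dimensions `≥ 1`).  A map `φ : ℙ(R) → ℙ(R')`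
is a `△`-isomorphism iff `m = m'` and there are a permutation `σ` of `{1,…,m}` and
`△`-isomorphisms `φ_k : ℙ(R_k) → ℙ(R'_{σ k})` with `(φ p)_{σ k} = φ_k (p_k)`.
Moreover, if `dim U_i > 1` for all `i`, then `φ = α̃ ∘ γ̃` with `γ ∈ GL₂(R')` and a Jordan
isomorphism `α : R → R'` such that `(x^α)_{σ k} = (x_k)^{α_k}` with each
`α_k : R_k → R'_{σ k}` an isomorphism or an anti-isomorphism. -/
theorem stmt_16 {m m' : ℕ} (hm : 0 < m) (hm' : 0 < m')
    {K U : Fin m → Type*} [∀ i, DivisionRing (K i)] [∀ i, AddCommGroup (U i)]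
    [∀ i, Module (K i) (U i)] [∀ i, FiniteDimensional (K i) (U i)]
    {K' U' : Fin m' → Type*} [∀ j, DivisionRing (K' j)] [∀ j, AddCommGroup (U' j)]
    [∀ j, Module (K' j) (U' j)] [∀ j, FiniteDimensional (K' j) (U' j)]
    (hdim : ∀ i, 1 ≤ Module.finrank (K i) (U i))
    (hdim' : ∀ j, 1 ≤ Module.finrank (K' j) (U' j))
    (φ : PL (Π i, EndOp (K i) (U i)) → PL (Π j, EndOp (K' j) (U' j))) :
    ((Function.Bijective φ ∧
        ∀ p q, (Distant p.1 q.1 ↔ Distant (φ p).1 (φ q).1)) ↔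
      (m = m' ∧ ∃ σ : Fin m ≃ Fin m',
        ∃ φc : ∀ k : Fin m,
          Submodule (EndOp (K k) (U k)) (EndOp (K k) (U k) × EndOp (K k) (U k)) →
          Submodule (EndOp (K' (σ k)) (U' (σ k)))
            (EndOp (K' (σ k)) (U' (σ k)) × EndOp (K' (σ k)) (U' (σ k))),
          (∀ k, IsDisIso (φc k)) ∧
          ∀ (p : PL (Π i, EndOp (K i) (U i))) (k : Fin m),
            component (φ p).1 (σ k) = φc k (component p.1 k))) ∧
    ((Function.Bijective φ ∧
        ∀ p q, (Distant p.1 q.1 ↔ Distant (φ p).1 (φ q).1)) →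
      (∀ i, 1 < Module.finrank (K i) (U i)) →
      ∃ (γ : (Matrix (Fin 2) (Fin 2) (Π j, EndOp (K' j) (U' j)))ˣ)
        (α : (Π i, EndOp (K i) (U i)) → (Π j, EndOp (K' j) (U' j)))
        (σ : Fin m ≃ Fin m')
        (αc : ∀ k : Fin m, EndOp (K k) (U k) → EndOp (K' (σ k)) (U' (σ k))),
        Function.Bijective α ∧ (∀ x y, α (x + y) = α x + α y) ∧ α 1 = 1 ∧
        (∀ x y, α (x * y * x) = α x * α y * α x) ∧
        (∀ x k, α x (σ k) = αc k (x k)) ∧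
        (∀ k, Function.Bijective (αc k) ∧
          (∀ x y, αc k (x + y) = αc k x + αc k y) ∧ αc k 1 = 1 ∧
          ((∀ x y, αc k (x * y) = αc k x * αc k y) ∨
            (∀ x y, αc k (x * y) = αc k y * αc k x))) ∧
        (∀ (p : PL (Π i, EndOp (K i) (U i))) (a b : Π i, EndOp (K i) (U i)),
          p.1 = Submodule.span (Π i, EndOp (K i) (U i)) {(a * b - 1, a)} →
          (φ p).1 = Submodule.span (Π j, EndOp (K' j) (U' j))
            {rowMul (α a * α b - 1) (α a) γ.val})) := by
  have hR := fun i => isGeometry_pointDistant (hdim i)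
  have hS := fun j => isGeometry_pointDistant (hdim' j)
  refine ⟨⟨fun ⟨hφ, hφd⟩ => ?_, fun ⟨_, σ, φc, hφc, h⟩ => bijective_of_components φ σ φc hφc h⟩,
    fun ⟨hφ, hφd⟩ hdim2 => ?_⟩
  · obtain ⟨σ, f, hf, h⟩ := exists_components hR hS hφ hφd
    choose φc hφc hφf using fun k => exists_isDisIso (f k) (hf k)
    refine ⟨Fin.equiv_iff_eq.1 ⟨σ⟩, σ, φc, hφc, fun p k => ?_⟩
    exact (congrArg Subtype.val (h p k)).trans (hφf k _).symm
  · obtain ⟨σ, f, hf, h⟩ := exists_components hR hS hφ hφd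
    choose g αc hα hαf using fun k => exists_isIsoOrAnti (hdim2 k) (f k) (hf k)
    obtain ⟨γ, hγ⟩ := exists_reindex_unit (S := fun j => EndOp (K' j) (U' j)) σ g
    refine ⟨γ, reindexMap σ αc, σ, αc, reindexMap_bijective σ fun k => (hα k).bijective,
      fun x y => forall_eq_of_reindex σ fun k => ?_, forall_eq_of_reindex σ fun k => ?_,
      fun x y => forall_eq_of_reindex σ fun k => ?_,
      fun x k => reindexMap_apply (R := fun i => EndOp (K i) (U i))
        (S := fun j => EndOp (K' j) (U' j)) σ αc x k,
      fun k => ⟨(hα k).bijective, (hα k).map_add, (hα k).map_one, (hα k).map_mul⟩,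
      fun p a b hp => ?_⟩
    · simp only [Pi.add_apply, reindexMap_apply, (hα k).map_add]
    · simp only [Pi.one_apply, reindexMap_apply, (hα k).map_one]
    · simp only [Pi.mul_apply, reindexMap_apply]
      rcases (hα k).map_mul with hm | hm
      · rw [hm, hm]
      · rw [hm, hm, mul_assoc]
    · obtain rfl : p = jordanPoint a b := Subtype.ext hp
      obtain ⟨c, d, hcd⟩ := IsPoint.exists_span (φ (jordanPoint a b)).2
      rw [hcd]
      refine span_eq_span_of_component_eq fun j => ?_
      obtain ⟨k, rfl⟩ := σ.surjective j
      rw [← hcd, ← componentsEquiv_apply, h, component_jordanPoint, hαf, component_span]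
      simp [rowMul, hγ, reindexMap_apply]
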